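/- arXiv:math/0401248 — 2 statements merged into one kernel-verified Lean document; each statement's English description precedes it below -/
import Mathlib

section
/- For every ε > 0 there exist ρ₀ > 0 and a constant C_ε > 0 such that for every segment Λ ⊂ ℤ with |Λ| = L, every N ≥ 1 with N/L ≤ ρ₀ and every f ≥ 0, ν_Λ^N[ f , Σ_{x∈Λ} c(η_x) ]² ≤ N ν_Λ^N[f] ( C_ε ν_Λ^N[f] + ε Ent_{ν_Λ^N}(f) ). -/
open scoped BigOperators

noncomputable section

/-- `cfact c k = c(k)! = c(1)⋯c(k)`, with `cfact c 0 = 1`. -/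
def cfact (c : ℕ → ℝ) : ℕ → ℝ
  | 0 => 1
  | k + 1 => cfact c k * c (k + 1)

/-- The configuration obtained from `η` by moving one particle from `x` to `y` (`x ≠ y`),
i.e. `η - δ^x + δ^y`. -/
def move (η : ℤ → ℕ) (x y : ℤ) : ℤ → ℕ :=
  fun z => if z = x then η x - 1 else if z = y then η y + 1 else η z

/-- Unnormalized weight of the canonical measure `ν_Λ^N` on configurations supported in `Λ`
with `N` particles: `∏_{x∈Λ} 1/c(η_x)!`. -/
def nuW (c : ℕ → ℝ) (Λ : Finset ℤ) (N : ℕ) : (ℤ → ℕ) → ℝ :=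
  Set.indicator {η : ℤ → ℕ | (∀ x, x ∉ Λ → η x = 0) ∧ (∑ x ∈ Λ, η x) = N}
    (fun η => ∏ x ∈ Λ, (cfact c (η x))⁻¹)

/-- Expectation with respect to the probability measure obtained by normalizing the
nonnegative weight `w`. -/
def wE (w f : (ℤ → ℕ) → ℝ) : ℝ :=
  (∑' η : ℤ → ℕ, w η * f η) / (∑' η : ℤ → ℕ, w η)

/-- Covariance `μ[f,g] = μ[f g] - μ[f] μ[g]`. -/
def wCov (w f g : (ℤ → ℕ) → ℝ) : ℝ :=
  wE w (fun η => f η * g η) - wE w f * wE w g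

/-- Entropy `Ent_μ(f) = μ[f log f] - μ[f] log μ[f]` (note `Real.log 0 = 0`, giving the
convention `0 log 0 = 0`). -/
def wEnt (w f : (ℤ → ℕ) → ℝ) : ℝ :=
  wE w (fun η => f η * Real.log (f η)) - wE w f * Real.log (wE w f)

/-- Dirichlet form of the zero-range process on `Λ`:
`E(f,g) = (1/2) Σ_{x∈Λ} Σ_{y∈Λ, |x-y|=1} μ[c(η_x) ∂_{xy}f ∂_{xy}g]`. -/
def wDir (c : ℕ → ℝ) (Λ : Finset ℤ) (w f g : (ℤ → ℕ) → ℝ) : ℝ :=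
  wE w (fun η => (1 / 2) * ∑ x ∈ Λ, ∑ y ∈ Λ,
    if |x - y| = 1 then c (η x) * ((f (move η x y) - f η) * (g (move η x y) - g η)) else 0)

/-- Weight conditioned on the event `∑_{x ∈ Λ₁} η x = n`. -/
def condW (w : (ℤ → ℕ) → ℝ) (Λ₁ : Finset ℤ) (n : ℕ) : (ℤ → ℕ) → ℝ :=
  Set.indicator {η : ℤ → ℕ | (∑ x ∈ Λ₁, η x) = n} w

/-- `h(n) = (n+1)/c(n+1)`. -/
def hfun (c : ℕ → ℝ) (n : ℕ) : ℝ := (n + 1) / c (n + 1)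


/-- Configurations with `N` particles in `Λ`. -/
abbrev XX (Λ : Finset ℤ) (N : ℕ) : Finset (ℤ → ℕ) := Finset.piAntidiag Λ N

abbrev dl (x : ℤ) : ℤ → ℕ := Pi.single x 1

def Wt (p : ℕ → ℝ) (Λ : Finset ℤ) (η : ℤ → ℕ) : ℝ := ∏ x ∈ Λ, p (η x)

def Hs (h : ℕ → ℝ) (Λ : Finset ℤ) (ζ : ℤ → ℕ) : ℝ := ∑ y ∈ Λ, h (ζ y)

def Rop (h : ℕ → ℝ) (Λ : Finset ℤ) (F : (ℤ → ℕ) → ℝ) (ζ : ℤ → ℕ) : ℝ :=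
  (∑ y ∈ Λ, h (ζ y) * F (ζ + dl y)) / Hs h Λ ζ

def Dop (Λ : Finset ℤ) (n : ℝ) (g : (ℤ → ℕ) → ℝ) (η : ℤ → ℕ) : ℝ :=
  (∑ x ∈ Λ, (η x : ℝ) * g (η - dl x)) / n

lemma mem_XX {Λ : Finset ℤ} {N : ℕ} {η : ℤ → ℕ} :
    η ∈ XX Λ N ↔ Λ.sum η = N ∧ ∀ i, η i ≠ 0 → i ∈ Λ := Finset.mem_piAntidiag

lemma add_dl_mem {Λ : Finset ℤ} {N : ℕ} {η : ℤ → ℕ} (h : η ∈ XX Λ N) {x : ℤ} (hx : x ∈ Λ) :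
    η + dl x ∈ XX Λ (N + 1) := by
  rw [mem_XX] at h ⊢
  refine ⟨?_, ?_⟩
  · simp only [Pi.add_apply, Finset.sum_add_distrib, h.1]
    simp [dl, Finset.sum_pi_single', hx]
  · intro i hi
    by_cases hix : i = x
    · rwa [hix]
    · apply h.2
      simpa [dl, Pi.single_apply, hix] using hi

lemma sub_dl_add {η : ℤ → ℕ} {x : ℤ} (hx : η x ≠ 0) : η - dl x + dl x = η := by
  funext i
  by_cases hix : i = x
  · subst hix; simp [dl]; omega
  · simp [dl, Pi.single_apply, hix]

lemma sub_dl_mem {Λ : Finset ℤ} {N : ℕ} {η : ℤ → ℕ} (h : η ∈ XX Λ (N + 1)) {x : ℤ}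
    (hx : η x ≠ 0) : η - dl x ∈ XX Λ N := by
  rw [mem_XX] at h ⊢
  have hxΛ := h.2 x hx
  refine ⟨?_, ?_⟩
  · have h1 : Λ.sum (η - dl x + dl x) = N + 1 := by rw [sub_dl_add hx]; exact h.1
    simp only [Pi.add_apply, Finset.sum_add_distrib] at h1
    have h2 : ∑ i ∈ Λ, dl x i = 1 := by simp [dl, Finset.sum_pi_single', hxΛ]
    rw [h2] at h1
    have : Λ.sum (η - dl x) = ∑ i ∈ Λ, (η - dl x) i := rfl
    omega
  · intro i hi
    apply h.2
    intro h0
    apply hi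
    simp [h0]

lemma change_var (Λ : Finset ℤ) (M : ℕ) (g : (ℤ → ℕ) → ℤ → ℝ)
    (hg : ∀ η x, η x = 0 → g η x = 0) :
    ∑ η ∈ XX Λ (M + 1), ∑ x ∈ Λ, g η x = ∑ ζ ∈ XX Λ M, ∑ x ∈ Λ, g (ζ + dl x) x := by
  rw [Finset.sum_comm, Finset.sum_comm (s := XX Λ M)]
  refine Finset.sum_congr rfl fun x hx => ?_
  symm
  refine Finset.sum_bij_ne_zero (fun ζ _ _ => ζ + dl x) ?_ ?_ ?_ ?_
  · intro ζ hζ _; exact add_dl_mem hζ hx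
  · intro a _ _ b _ _ hab; exact add_right_cancel hab
  · intro η hη hne
    have h0 : η x ≠ 0 := fun h => hne (hg η x h)
    refine ⟨η - dl x, sub_dl_mem hη h0, ?_, sub_dl_add h0⟩
    rwa [sub_dl_add h0]
  · intros; rfl

lemma Wt_add (p h : ℕ → ℝ) (hp : ∀ n, 0 < p n) (hh : ∀ n, h n * p n = (n + 1) * p (n + 1))
    (Λ : Finset ℤ) (ζ : ℤ → ℕ) {x : ℤ} (hx : x ∈ Λ) :
    Wt p Λ (ζ + dl x) * ((ζ x : ℝ) + 1) = Wt p Λ ζ * h (ζ x) := by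
  unfold Wt
  rw [← Finset.mul_prod_erase Λ _ hx, ← Finset.mul_prod_erase Λ (fun y => p (ζ y)) hx]
  have h1 : ∏ y ∈ Λ.erase x, p ((ζ + dl x) y) = ∏ y ∈ Λ.erase x, p (ζ y) := by
    refine Finset.prod_congr rfl fun y hy => ?_
    have : y ≠ x := Finset.ne_of_mem_erase hy
    simp [dl, Pi.single_apply, this]
  rw [h1]
  have h2 : (ζ + dl x) x = ζ x + 1 := by simp [dl]
  rw [h2]
  linear_combination (-(∏ y ∈ Λ.erase x, p (ζ y))) * hh (ζ x)

lemma Wt_pos (p : ℕ → ℝ) (hp : ∀ n, 0 < p n) (Λ : Finset ℤ) (η : ℤ → ℕ) : 0 < Wt p Λ η :=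
  Finset.prod_pos fun _ _ => hp _

lemma adj (p h : ℕ → ℝ) (hp : ∀ n, 0 < p n) (hh : ∀ n, h n * p n = (n + 1) * p (n + 1))
    (Λ : Finset ℤ) (M : ℕ) (hH : ∀ ζ, 0 < Hs h Λ ζ) (F g : (ℤ → ℕ) → ℝ) :
    ∑ η ∈ XX Λ (M + 1), Wt p Λ η * F η * Dop Λ (M + 1) g η
      = ∑ ζ ∈ XX Λ M, (Wt p Λ ζ * Hs h Λ ζ / (M + 1)) * g ζ * Rop h Λ F ζ := by
  have e1 : ∀ η, Wt p Λ η * F η * Dop Λ (M + 1) g η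
      = ∑ x ∈ Λ, Wt p Λ η * F η * ((η x : ℝ) * g (η - dl x)) / (M + 1) := by
    intro η
    rw [Dop, ← Finset.sum_div, ← Finset.mul_sum, mul_div_assoc]
  simp_rw [e1]
  rw [change_var Λ M (fun η x => Wt p Λ η * F η * ((η x : ℝ) * g (η - dl x)) / (M + 1))]
  · refine Finset.sum_congr rfl fun ζ _ => ?_
    have : (Wt p Λ ζ * Hs h Λ ζ / (M + 1)) * g ζ * Rop h Λ F ζ
        = ∑ x ∈ Λ, Wt p Λ ζ * g ζ * (h (ζ x) * F (ζ + dl x)) / (M + 1) := by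
      rw [Rop, ← Finset.sum_div, ← Finset.mul_sum]
      have := (hH ζ).ne'
      field_simp
    rw [this]
    refine Finset.sum_congr rfl fun x hx => ?_
    have h2 : (ζ + dl x) - dl x = ζ := by funext i; simp
    have h3 : (((ζ + dl x) x : ℕ) : ℝ) = (ζ x : ℝ) + 1 := by simp [dl]
    rw [h2, h3]
    have := Wt_add p h hp hh Λ ζ hx
    congr 1
    linear_combination (F (ζ + dl x) * g ζ) * this
  · intro η x h0
    simp [h0]

lemma Rop_one (h : ℕ → ℝ) (Λ : Finset ℤ) (hH : ∀ ζ, 0 < Hs h Λ ζ) (ζ : ℤ → ℕ) :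
    Rop h Λ (fun _ => 1) ζ = 1 := by
  have := (hH ζ).ne'
  simp only [Rop, mul_one]
  exact div_self this

lemma Dop_one (Λ : Finset ℤ) (M : ℕ) {η : ℤ → ℕ} (hη : η ∈ XX Λ (M + 1)) :
    Dop Λ (M + 1) (fun _ => 1) η = 1 := by
  have := (mem_XX.1 hη).1
  simp only [Dop, mul_one]
  rw [← Nat.cast_sum, this]
  push_cast
  exact div_self (by positivity)

def Pop (h : ℕ → ℝ) (Λ : Finset ℤ) (M : ℕ) (F : (ℤ → ℕ) → ℝ) : (ℤ → ℕ) → ℝ :=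
  Dop Λ (M + 1) (Rop h Λ F)

def ip (p : ℕ → ℝ) (Λ : Finset ℤ) (N : ℕ) (F G : (ℤ → ℕ) → ℝ) : ℝ :=
  ∑ η ∈ XX Λ N, Wt p Λ η * F η * G η

lemma ip_comm (p : ℕ → ℝ) (Λ : Finset ℤ) (N : ℕ) (F G : (ℤ → ℕ) → ℝ) :
    ip p Λ N F G = ip p Λ N G F :=
  Finset.sum_congr rfl fun _ _ => by ring

lemma ip_Pop (p h : ℕ → ℝ) (hp : ∀ n, 0 < p n) (hh : ∀ n, h n * p n = (n + 1) * p (n + 1))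
    (Λ : Finset ℤ) (M : ℕ) (hH : ∀ ζ, 0 < Hs h Λ ζ) (F G : (ℤ → ℕ) → ℝ) :
    ip p Λ (M + 1) F (Pop h Λ M G) = ip p Λ (M + 1) (Pop h Λ M F) G := by
  rw [ip_comm p Λ (M + 1) (Pop h Λ M F) G]
  unfold ip Pop
  rw [adj p h hp hh Λ M hH, adj p h hp hh Λ M hH]
  exact Finset.sum_congr rfl fun _ _ => by ring

lemma ip_one_Pop (p h : ℕ → ℝ) (hp : ∀ n, 0 < p n)
    (hh : ∀ n, h n * p n = (n + 1) * p (n + 1))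
    (Λ : Finset ℤ) (M : ℕ) (hH : ∀ ζ, 0 < Hs h Λ ζ) (G : (ℤ → ℕ) → ℝ) :
    ip p Λ (M + 1) (fun _ => 1) (Pop h Λ M G) = ip p Λ (M + 1) (fun _ => 1) G := by
  rw [ip_Pop p h hp hh Λ M hH]
  refine Finset.sum_congr rfl fun η hη => ?_
  have : Rop h Λ (fun _ => 1) = fun _ => 1 := funext (Rop_one h Λ hH)
  rw [Pop, this, Dop_one Λ M hη]

lemma ip_cs (p : ℕ → ℝ) (hp : ∀ n, 0 < p n) (Λ : Finset ℤ) (N : ℕ) (F G : (ℤ → ℕ) → ℝ) :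
    (ip p Λ N F G) ^ 2 ≤ ip p Λ N F F * ip p Λ N G G := by
  unfold ip
  refine Finset.sum_sq_le_sum_mul_sum_of_sq_le_mul _ ?_ ?_ ?_
  · intro η _; have := Wt_pos p hp Λ η; nlinarith [mul_nonneg this.le (mul_self_nonneg (F η))]
  · intro η _; have := Wt_pos p hp Λ η; nlinarith [mul_nonneg this.le (mul_self_nonneg (G η))]
  · intro η _; exact le_of_eq (by ring)

/-- Lipschitz condition. -/
def LipB (Λ : Finset ℤ) (M : ℕ) (F : (ℤ → ℕ) → ℝ) (l : ℝ) : Prop :=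
  ∀ ζ ∈ XX Λ M, ∀ x ∈ Λ, ∀ y ∈ Λ, |F (ζ + dl x) - F (ζ + dl y)| ≤ l

lemma Hs_bounds (h : ℕ → ℝ) (α β : ℝ) (hα : ∀ n, α ≤ h n) (Λ : Finset ℤ)
    (ζ : ℤ → ℕ) : α * Λ.card ≤ Hs h Λ ζ := by
  have := Finset.card_nsmul_le_sum Λ (fun y => h (ζ y)) α (fun y _ => hα _)
  rw [nsmul_eq_mul] at this
  rw [Hs]; linarith

lemma Rop_lip (h : ℕ → ℝ) (α β : ℝ) (hα0 : 0 < α) (hα : ∀ n, α ≤ h n) (hβ : ∀ n, h n ≤ β)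
    (Λ : Finset ℤ) (hΛ : 0 < Λ.card) (M : ℕ) (F : (ℤ → ℕ) → ℝ) (l : ℝ)
    (hF : LipB Λ (M + 1) F l) (ξ : ℤ → ℕ) (hξ : ξ ∈ XX Λ M) (x y : ℤ) (hx : x ∈ Λ)
    (hy : y ∈ Λ) :
    |Rop h Λ F (ξ + dl x) - Rop h Λ F (ξ + dl y)| ≤ l * (1 + 2 * β / (α * Λ.card)) := by
  have hl : 0 ≤ l := le_trans (abs_nonneg _) (hF _ (add_dl_mem hξ hx) x hx x hx)
  have hc : (0 : ℝ) < Λ.card := by exact_mod_cast hΛ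
  have hHl := Hs_bounds h α β hα Λ
  have hH : ∀ ζ, 0 < Hs h Λ ζ := fun ζ => lt_of_lt_of_le (by positivity) (hHl ζ)
  have hβ0 : 0 < β := lt_of_lt_of_le hα0 ((hα 0).trans (hβ 0))
  have hh0 : ∀ n, 0 < h n := fun n => lt_of_lt_of_le hα0 (hα n)
  set A := ξ + dl x with hA
  set B := ξ + dl y with hB
  have hRB : ∑ v ∈ Λ, h (B v) * F (B + dl v) = Rop h Λ F B * Hs h Λ B := by
    rw [Rop, div_mul_cancel₀ _ (hH B).ne']
  have hRA : ∑ v ∈ Λ, h (A v) * F (A + dl v) = Rop h Λ F A * Hs h Λ A := by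
    rw [Rop, div_mul_cancel₀ _ (hH A).ne']
  -- deviation
  have hdev : ∀ v ∈ Λ, |F (B + dl v) - Rop h Λ F B| ≤ l := by
    intro v hv
    have e : F (B + dl v) - Rop h Λ F B
        = (∑ u ∈ Λ, h (B u) * (F (B + dl v) - F (B + dl u))) / Hs h Λ B := by
      rw [eq_div_iff (hH B).ne', sub_mul, ← hRB, Hs, Finset.mul_sum, ← Finset.sum_sub_distrib]
      exact Finset.sum_congr rfl fun _ _ => by ring
    rw [e, abs_div, abs_of_pos (hH B), div_le_iff₀ (hH B)]
    refine (Finset.abs_sum_le_sum_abs _ _).trans ?_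
    rw [Hs, Finset.mul_sum]
    refine Finset.sum_le_sum fun u hu => ?_
    rw [abs_mul, abs_of_pos (hh0 _), mul_comm]
    exact mul_le_mul_of_nonneg_right (hF B (add_dl_mem hξ hy) v hv u hu) (hh0 _).le
  have key : (Rop h Λ F A - Rop h Λ F B) * Hs h Λ A
      = ∑ v ∈ Λ, h (A v) * (F (A + dl v) - F (B + dl v))
        + ∑ v ∈ Λ, (h (A v) - h (B v)) * (F (B + dl v) - Rop h Λ F B) := by
    have z : ∑ v ∈ Λ, h (B v) * (F (B + dl v) - Rop h Λ F B) = 0 := by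
      simp_rw [mul_sub]
      rw [Finset.sum_sub_distrib, hRB, ← Finset.sum_mul, Hs]; ring
    rw [sub_mul, ← hRA, Hs, Finset.mul_sum, ← sub_zero (_ - _), ← z,
      ← Finset.sum_sub_distrib, ← Finset.sum_sub_distrib, ← Finset.sum_add_distrib]
    exact Finset.sum_congr rfl fun _ _ => by ring
  have b1 : |∑ v ∈ Λ, h (A v) * (F (A + dl v) - F (B + dl v))| ≤ l * Hs h Λ A := by
    refine (Finset.abs_sum_le_sum_abs _ _).trans ?_
    rw [Hs, Finset.mul_sum]
    refine Finset.sum_le_sum fun v hv => ?_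
    rw [abs_mul, abs_of_pos (hh0 _), mul_comm]
    refine mul_le_mul_of_nonneg_right ?_ (hh0 _).le
    have := hF (ξ + dl v) (add_dl_mem hξ hv) x hx y hy
    rwa [add_right_comm, add_right_comm ξ (dl v)] at this
  have b2 : |∑ v ∈ Λ, (h (A v) - h (B v)) * (F (B + dl v) - Rop h Λ F B)| ≤ 2 * β * l := by
    refine (Finset.abs_sum_le_sum_abs _ _).trans ?_
    have : ∀ v ∈ Λ, |(h (A v) - h (B v)) * (F (B + dl v) - Rop h Λ F B)|
        ≤ (if v = x then β * l else 0) + (if v = y then β * l else 0) := by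
      intro v hv
      by_cases hvx : v = x ∨ v = y
      · have h1 : |h (A v) - h (B v)| ≤ β := by
          rw [abs_le]
          constructor <;> linarith [hh0 (A v), hh0 (B v), hβ (A v), hβ (B v)]
        have h2 : |(h (A v) - h (B v)) * (F (B + dl v) - Rop h Λ F B)| ≤ β * l := by
          rw [abs_mul]
          exact mul_le_mul h1 (hdev v hv) (abs_nonneg _) hβ0.le
        have h3 : 0 ≤ β * l := by positivity
        rcases hvx with hv1 | hv1
        · rw [if_pos hv1]; split_ifs <;> linarith
        · rw [if_pos hv1]; split_ifs <;> linarith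
      · push Not at hvx
        have h1 : A v = B v := by simp [A, B, dl, Pi.single_apply, hvx.1, hvx.2]
        simp [h1, hvx.1, hvx.2]
    refine (Finset.sum_le_sum this).trans ?_
    rw [Finset.sum_add_distrib, Finset.sum_ite_eq', Finset.sum_ite_eq', if_pos hx, if_pos hy]
    linarith
  have b3 : |Rop h Λ F A - Rop h Λ F B| * Hs h Λ A ≤ l * Hs h Λ A + 2 * β * l := by
    rw [← abs_of_pos (hH A), ← abs_mul, key, abs_of_pos (hH A)]
    exact (abs_add_le _ _).trans (add_le_add b1 b2)
  have b4 : |Rop h Λ F A - Rop h Λ F B| ≤ l + 2 * β * l / Hs h Λ A := by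
    rw [← sub_le_iff_le_add', le_div_iff₀ (hH A)]
    linarith
  refine b4.trans ?_
  have b5 : 2 * β * l / Hs h Λ A ≤ 2 * β * l / (α * Λ.card) :=
    div_le_div_of_nonneg_left (by positivity) (by positivity) (hHl A)
  have : l * (1 + 2 * β / (α * Λ.card)) = l + 2 * β * l / (α * Λ.card) := by ring
  rw [this]; linarith

lemma Pop_lip (h : ℕ → ℝ) (α β : ℝ) (hα0 : 0 < α) (hα : ∀ n, α ≤ h n) (hβ : ∀ n, h n ≤ β)
    (Λ : Finset ℤ) (hΛ : 0 < Λ.card) (M : ℕ)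
    (hden : 2 * β / (α * Λ.card) * (M + 1) ≤ 1 / 2)
    (F : (ℤ → ℕ) → ℝ) (l : ℝ) (hl : 0 ≤ l)
    (hF : LipB Λ M F l) : LipB Λ M (Pop h Λ M F) (l * (1 - 1 / (2 * (M + 1)))) := by
  intro ζ hζ x hx y hy
  have hβ0 : 0 < β := lt_of_lt_of_le hα0 ((hα 0).trans (hβ 0))
  have hc : (0 : ℝ) < Λ.card := by exact_mod_cast hΛ
  have ex : ∀ x ∈ Λ, Pop h Λ M F (ζ + dl x)
      = (Rop h Λ F ζ + ∑ z ∈ Λ, (ζ z : ℝ) * Rop h Λ F (ζ - dl z + dl x)) / (M + 1) := by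
    intro x hx
    rw [Pop, Dop]
    congr 1
    have h1 : ∀ z ∈ Λ, (((ζ + dl x) z : ℕ) : ℝ) * Rop h Λ F (ζ + dl x - dl z)
        = (if z = x then Rop h Λ F ζ else 0) + (ζ z : ℝ) * Rop h Λ F (ζ - dl z + dl x) := by
      intro z _
      have e0 : ζ + dl x - dl x = ζ := by funext i; simp
      have e2 : (ζ z : ℝ) * Rop h Λ F (ζ + dl x - dl z)
          = (ζ z : ℝ) * Rop h Λ F (ζ - dl z + dl x) := by
        by_cases hz : ζ z = 0
        · simp [hz]
        · have : ζ + dl x - dl z = ζ - dl z + dl x := by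
            conv_lhs => rw [← sub_dl_add hz]
            funext i; simp [add_right_comm]
          rw [this]
      rw [← e2]
      by_cases hzx : z = x
      · subst hzx; rw [e0]; simp [dl]; ring
      · simp [dl, Pi.single_apply, hzx]
    rw [Finset.sum_congr rfl h1, Finset.sum_add_distrib, Finset.sum_ite_eq', if_pos hx]
  rw [ex x hx, ex y hy, ← sub_div, add_sub_add_left_eq_sub, ← Finset.sum_sub_distrib]
  have hM : (0 : ℝ) < M + 1 := by positivity
  rw [abs_div, abs_of_pos hM, div_le_iff₀ hM]
  have hsum : ∑ z ∈ Λ, (ζ z : ℝ) = M := by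
    rw [← Nat.cast_sum, (mem_XX.1 hζ).1]
  calc |∑ z ∈ Λ, ((ζ z : ℝ) * Rop h Λ F (ζ - dl z + dl x)
        - (ζ z : ℝ) * Rop h Λ F (ζ - dl z + dl y))|
      ≤ ∑ z ∈ Λ, (ζ z : ℝ) * (l * (1 + 2 * β / (α * Λ.card))) := by
        refine (Finset.abs_sum_le_sum_abs _ _).trans (Finset.sum_le_sum fun z _ => ?_)
        rw [← mul_sub, abs_mul, Nat.abs_cast]
        by_cases hz : ζ z = 0
        · simp [hz]
        · refine mul_le_mul_of_nonneg_left ?_ (Nat.cast_nonneg _)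
          have hM0 : M ≠ 0 := by
            rintro rfl
            have := (mem_XX.1 hζ)
            exact hz ((Finset.sum_eq_zero_iff.1 this.1) z (this.2 z hz))
          obtain ⟨M', rfl⟩ := Nat.exists_eq_succ_of_ne_zero hM0
          exact Rop_lip h α β hα0 hα hβ Λ hΛ M' F l hF _ (sub_dl_mem hζ hz) x y hx hy
    _ = M * (l * (1 + 2 * β / (α * Λ.card))) := by rw [← Finset.sum_mul, hsum]
    _ = l * (M + 2 * β / (α * Λ.card) * M) := by ring
    _ ≤ l * (M + 1 / 2) := by
        refine mul_le_mul_of_nonneg_left ?_ hl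
        have : 0 ≤ 2 * β / (α * Λ.card) := by positivity
        linarith
    _ = l * (1 - 1 / (2 * (M + 1))) * (M + 1) := by field_simp; ring

lemma lip_osc (Λ : Finset ℤ) (l : ℝ) (M : ℕ) : ∀ (F : (ℤ → ℕ) → ℝ), LipB Λ M F l →
    ∀ η ∈ XX Λ (M + 1), ∀ η' ∈ XX Λ (M + 1), |F η - F η'| ≤ (M + 1) * l := by
  have ex : ∀ (M : ℕ), ∀ η ∈ XX Λ (M + 1), ∃ x ∈ Λ, η x ≠ 0 := by
    intro M η hη
    by_contra hcon
    push Not at hcon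
    have := (mem_XX.1 hη).1
    rw [Finset.sum_eq_zero hcon] at this
    omega
  induction M with
  | zero =>
    intro F hF η hη η' hη'
    obtain ⟨x, hx, hx0⟩ := ex 0 η hη
    obtain ⟨y, hy, hy0⟩ := ex 0 η' hη'
    have h1 := sub_dl_mem hη hx0
    have h2 := sub_dl_mem hη' hy0
    have h3 : η - dl x = η' - dl y := by
      have : XX Λ 0 = {0} := by simp [XX]
      rw [this, Finset.mem_singleton] at h1 h2
      rw [h1, h2]
    rw [← sub_dl_add hx0, ← sub_dl_add hy0, ← h3]
    simpa using hF _ h1 x hx y hy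
  | succ M ih =>
    intro F hF η hη η' hη'
    obtain ⟨x, hx, hx0⟩ := ex _ η hη
    obtain ⟨y, hy, hy0⟩ := ex _ η' hη'
    have h1 := sub_dl_mem hη hx0
    have h2 := sub_dl_mem hη' hy0
    have h3 := ih (fun ζ => F (ζ + dl x)) (by
      intro ζ hζ u hu v hv
      have := hF (ζ + dl x) (add_dl_mem hζ hx) u hu v hv
      simpa only [add_right_comm] using this) _ h1 _ h2
    have h4 := hF _ h2 x hx y hy
    simp only [sub_dl_add hx0] at h3
    rw [sub_dl_add hy0] at h4
    have := abs_sub_le (F η) (F (η' - dl y + dl x)) (F η')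
    push_cast
    linarith

lemma logconv (b : ℕ → ℝ) (hb : ∀ j, 0 ≤ b j) (hc : ∀ j, b (j + 1) ^ 2 ≤ b j * b (j + 2))
    (K q : ℝ) (hq : 0 ≤ q) (hK : ∀ j, b j ≤ K * q ^ j) : b 1 ≤ q * b 0 := by
  by_contra hcon
  push Not at hcon
  have hb0 : 0 < b 0 := by
    rcases (hb 0).eq_or_lt with h | h
    · have := hc 0
      rw [← h] at this hcon
      simp at this hcon
      rw [this] at hcon
      exact absurd hcon (lt_irrefl _)
    · exact h
  set r := b 1 / b 0 with hr
  have hrq : q < r := by rw [hr, lt_div_iff₀ hb0]; exact hcon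
  have hr0 : 0 < r := lt_of_le_of_lt hq hrq
  have step : ∀ j, 0 < b j ∧ r * b j ≤ b (j + 1) := by
    intro j
    induction j with
    | zero => exact ⟨hb0, by rw [hr, div_mul_cancel₀ _ hb0.ne']⟩
    | succ j ih =>
      have h1 : 0 < b (j + 1) := lt_of_lt_of_le (mul_pos hr0 ih.1) ih.2
      refine ⟨h1, ?_⟩
      have h2 := hc j
      have h3 : r * b (j + 1) * b j ≤ b (j + 2) * b j := by nlinarith
      exact le_of_mul_le_mul_right h3 ih.1
  have low : ∀ j, r ^ j * b 0 ≤ b j := by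
    intro j
    induction j with
    | zero => simp
    | succ j ih =>
      calc r ^ (j + 1) * b 0 = r * (r ^ j * b 0) := by ring
        _ ≤ r * b j := mul_le_mul_of_nonneg_left ih hr0.le
        _ ≤ _ := (step j).2
  have lim : Filter.Tendsto (fun j : ℕ => K * (q / r) ^ j) Filter.atTop (nhds (K * 0)) :=
    (tendsto_pow_atTop_nhds_zero_of_lt_one (by positivity)
      ((div_lt_one hr0).2 hrq)).const_mul K
  have : b 0 ≤ K * 0 := by
    refine ge_of_tendsto' lim fun j => ?_
    rw [div_pow, mul_div_assoc', le_div_iff₀ (by positivity)]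
    linarith [low j, hK j]
  linarith

lemma Rop_nonneg_sq (h : ℕ → ℝ) (Λ : Finset ℤ) (hH : ∀ ζ, 0 < Hs h Λ ζ)
    (G : (ℤ → ℕ) → ℝ) (ζ : ℤ → ℕ) (k : ℝ) :
    Rop h Λ (fun η => G η * G η) ζ - Rop h Λ G ζ * Rop h Λ G ζ
      ≤ Rop h Λ (fun η => (G η - k) ^ 2) ζ := by
  have e : Rop h Λ (fun η => (G η - k) ^ 2) ζ
      = Rop h Λ (fun η => G η * G η) ζ - 2 * k * Rop h Λ G ζ + k ^ 2 := by
    have hz := (hH ζ).ne'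
    have e1 : ∑ y ∈ Λ, h (ζ y) * (G (ζ + dl y) - k) ^ 2
        = ∑ y ∈ Λ, h (ζ y) * (G (ζ + dl y) * G (ζ + dl y))
          - 2 * k * ∑ y ∈ Λ, h (ζ y) * G (ζ + dl y) + k ^ 2 * Hs h Λ ζ := by
      rw [Hs, Finset.mul_sum, Finset.mul_sum, ← Finset.sum_sub_distrib, ← Finset.sum_add_distrib]
      exact Finset.sum_congr rfl fun _ _ => by ring
    simp only [Rop]
    rw [e1]
    field_simp
  rw [e]
  nlinarith [sq_nonneg (Rop h Λ G ζ - k)]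

lemma var_bound (p h : ℕ → ℝ) (hp : ∀ n, 0 < p n)
    (hh : ∀ n, h n * p n = (n + 1) * p (n + 1))
    (α β : ℝ) (hα0 : 0 < α) (hα : ∀ n, α ≤ h n) (hβ : ∀ n, h n ≤ β)
    (Λ : Finset ℤ) (hΛ : 0 < Λ.card) (M : ℕ)
    (hden : 2 * β / (α * Λ.card) * (M + 1) ≤ 1 / 2)
    (φ : ℕ → ℝ) (κ : ℝ) (hφ1 : φ 1 = φ 0) (hφ : ∀ n, |φ (n + 1) - φ n| ≤ κ)
    (m : ℝ)
    (hm : ip p Λ (M + 1) (fun _ => 1) (fun η => ∑ x ∈ Λ, φ (η x) - m) = 0) :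
    ip p Λ (M + 1) (fun η => ∑ x ∈ Λ, φ (η x) - m) (fun η => ∑ x ∈ Λ, φ (η x) - m)
      ≤ 2 * (M + 1) * (κ ^ 2 * (β / (α * Λ.card) * (M + 1)))
          * ip p Λ (M + 1) (fun _ => 1) (fun _ => 1) := by
  have hc : (0 : ℝ) < Λ.card := by exact_mod_cast hΛ
  have hHl := Hs_bounds h α β hα Λ
  have hH : ∀ ζ, 0 < Hs h Λ ζ := fun ζ => lt_of_lt_of_le (by positivity) (hHl ζ)
  have hβ0 : 0 < β := lt_of_lt_of_le hα0 ((hα 0).trans (hβ 0))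
  have hh0 : ∀ n, 0 < h n := fun n => lt_of_lt_of_le hα0 (hα n)
  have hκ : 0 ≤ κ := (abs_nonneg _).trans (hφ 0)
  have hM : (0 : ℝ) < M + 1 := by positivity
  set F : (ℤ → ℕ) → ℝ := fun η => ∑ x ∈ Λ, φ (η x) - m with hF
  -- increments
  have inc : ∀ ζ, ∀ y ∈ Λ, F (ζ + dl y) - F ζ = φ (ζ y + 1) - φ (ζ y) := by
    intro ζ y hy
    simp only [hF]
    rw [sub_sub_sub_cancel_right, ← Finset.sum_sub_distrib, Finset.sum_eq_single y]
    · simp [dl]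
    · intro b _ hb; simp [dl, hb]
    · intro h; exact absurd hy h
  have lipF : LipB Λ M F (2 * κ) := by
    intro ζ _ x hx y hy
    have e : F (ζ + dl x) - F (ζ + dl y)
        = (φ (ζ x + 1) - φ (ζ x)) - (φ (ζ y + 1) - φ (ζ y)) := by
      rw [← inc ζ x hx, ← inc ζ y hy]; ring
    rw [e]
    refine (abs_sub _ _).trans ?_
    linarith [hφ (ζ x), hφ (ζ y)]
  set θ : ℝ := 1 - 1 / (2 * (M + 1)) with hθ
  have hθ0 : 0 ≤ θ := by
    rw [hθ, sub_nonneg, div_le_one (by positivity)]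
    have : (0 : ℝ) ≤ M := Nat.cast_nonneg _
    linarith
  set G : ℕ → (ℤ → ℕ) → ℝ := fun j => (Pop h Λ M)^[j] F with hG
  have hGs : ∀ j, G (j + 1) = Pop h Λ M (G j) := by
    intro j; simp only [hG, Function.iterate_succ_apply']
  have lipG : ∀ j, LipB Λ M (G j) (2 * κ * θ ^ j) := by
    intro j
    induction j with
    | zero => simpa [hG] using lipF
    | succ j ih =>
      rw [hGs, pow_succ, ← mul_assoc]
      exact Pop_lip h α β hα0 hα hβ Λ hΛ M hden _ _ (by positivity) ih
  have meanG : ∀ j, ip p Λ (M + 1) (fun _ => 1) (G j) = 0 := by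
    intro j
    induction j with
    | zero => simpa [hG] using hm
    | succ j ih => rw [hGs, ip_one_Pop p h hp hh Λ M hH, ih]
  set Z := ip p Λ (M + 1) (fun _ => 1) (fun _ => 1) with hZ
  have hZ' : Z = ∑ η ∈ XX Λ (M + 1), Wt p Λ η := by simp [hZ, ip]
  have supG : ∀ j, ∀ η ∈ XX Λ (M + 1), |G j η| ≤ (M + 1) * (2 * κ * θ ^ j) := by
    intro j η hη
    have hZ0 : 0 < Z := by
      rw [hZ']; exact Finset.sum_pos (fun _ _ => Wt_pos p hp Λ _) ⟨η, hη⟩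
    have e : G j η * Z = ∑ η' ∈ XX Λ (M + 1), Wt p Λ η' * (G j η - G j η') := by
      have := meanG j
      simp only [ip, mul_one] at this
      simp_rw [mul_sub]
      rw [Finset.sum_sub_distrib, this, ← Finset.sum_mul, ← hZ']; ring
    have e2 : |G j η| * Z ≤ (M + 1) * (2 * κ * θ ^ j) * Z := by
      rw [← abs_of_pos hZ0, ← abs_mul, e, abs_of_pos hZ0, hZ', Finset.mul_sum]
      refine (Finset.abs_sum_le_sum_abs _ _).trans (Finset.sum_le_sum fun η' hη' => ?_)
      rw [abs_mul, abs_of_pos (Wt_pos p hp Λ _), mul_comm]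
      exact mul_le_mul_of_nonneg_right (lip_osc Λ _ M _ (lipG j) η hη η' hη')
        (Wt_pos p hp Λ _).le
    exact le_of_mul_le_mul_right e2 hZ0
  set b : ℕ → ℝ := fun j => ip p Λ (M + 1) (G j) (G j) with hb
  have hb0 : ∀ j, 0 ≤ b j := by
    intro j
    refine Finset.sum_nonneg fun η _ => ?_
    rw [mul_assoc]
    exact mul_nonneg (Wt_pos p hp Λ _).le (mul_self_nonneg _)
  have hbc : ∀ j, b (j + 1) ^ 2 ≤ b j * b (j + 2) := by
    intro j
    have : b (j + 1) = ip p Λ (M + 1) (G j) (G (j + 2)) := by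
      simp only [hb]
      rw [hGs (j + 1), ip_Pop p h hp hh Λ M hH, ← hGs]
    rw [this]
    exact ip_cs p hp Λ _ _ _
  have hbK : ∀ j, b j ≤ (((M + 1) * (2 * κ)) ^ 2 * Z) * (θ ^ 2) ^ j := by
    intro j
    have e : (((M + 1) * (2 * κ)) ^ 2 * Z) * (θ ^ 2) ^ j
        = ((M + 1) * (2 * κ * θ ^ j)) ^ 2 * Z := by
      rw [← pow_mul, mul_comm 2 j, pow_mul]; ring
    rw [e, hZ', Finset.mul_sum]
    refine Finset.sum_le_sum fun η hη => ?_
    rw [mul_assoc, mul_comm]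
    refine mul_le_mul_of_nonneg_right ?_ (Wt_pos p hp Λ _).le
    rw [← abs_mul_abs_self, ← sq]
    exact pow_le_pow_left₀ (abs_nonneg _) (supG j η hη) 2
  have h1 := logconv b hb0 hbc _ _ (sq_nonneg θ) hbK
  have hG0 : G 0 = F := rfl
  have hG1 : G 1 = Pop h Λ M F := rfl
  have h2 : ip p Λ (M + 1) F (Pop h Λ M F) ≤ θ * b 0 := by
    have := ip_cs p hp Λ (M + 1) (G 0) (G 1)
    rw [hG0, hG1] at this
    refine abs_le_of_sq_le_sq' ?_ (mul_nonneg hθ0 (hb0 0)) |>.2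
    refine this.trans ?_
    calc b 0 * b 1 ≤ b 0 * (θ ^ 2 * b 0) := mul_le_mul_of_nonneg_left h1 (hb0 0)
      _ = _ := by ring
  -- Dirichlet form
  have d1 : b 0 = ∑ ζ ∈ XX Λ M, (Wt p Λ ζ * Hs h Λ ζ / (M + 1)) *
      Rop h Λ (fun η => F η * F η) ζ := by
    have := adj p h hp hh Λ M hH (fun η => F η * F η) (fun _ => 1)
    simp only [mul_one] at this
    rw [← this]
    refine Finset.sum_congr rfl fun η hη => ?_
    rw [Dop_one Λ M hη, hG0]; ring
  have d2 : ip p Λ (M + 1) F (Pop h Λ M F) = ∑ ζ ∈ XX Λ M, (Wt p Λ ζ * Hs h Λ ζ / (M + 1)) *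
      (Rop h Λ F ζ * Rop h Λ F ζ) := by
    have := adj p h hp hh Λ M hH F (Rop h Λ F)
    simp only [mul_assoc] at this
    simp only [ip, Pop, mul_assoc]
    exact this
  have d3 : Z = ∑ ζ ∈ XX Λ M, (Wt p Λ ζ * Hs h Λ ζ / (M + 1)) := by
    have := adj p h hp hh Λ M hH (fun _ => 1) (fun _ => 1)
    simp only [mul_one, Rop_one h Λ hH] at this
    rw [← this, hZ']
    refine Finset.sum_congr rfl fun η hη => ?_
    rw [Dop_one Λ M hη]; ring
  have d4 : b 0 - ip p Λ (M + 1) F (Pop h Λ M F)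
      ≤ κ ^ 2 * (β / (α * Λ.card) * (M + 1)) * Z := by
    rw [d1, d2, d3, ← Finset.sum_sub_distrib, Finset.mul_sum]
    refine Finset.sum_le_sum fun ζ hζ => ?_
    rw [← mul_sub, mul_comm (κ ^ 2 * _)]
    refine mul_le_mul_of_nonneg_left ?_
      (div_nonneg (mul_nonneg (Wt_pos p hp Λ _).le (hH ζ).le) hM.le)
    refine (Rop_nonneg_sq h Λ hH F ζ (F ζ)).trans ?_
    rw [Rop]
    have s1 : ∑ y ∈ Λ, h (ζ y) * (F (ζ + dl y) - F ζ) ^ 2 ≤ κ ^ 2 * β * M := by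
      have hsum : ∑ z ∈ Λ, (ζ z : ℝ) = M := by
        rw [← Nat.cast_sum, (mem_XX.1 hζ).1]
      rw [← hsum, Finset.mul_sum]
      refine Finset.sum_le_sum fun y hy => ?_
      rw [inc ζ y hy]
      by_cases hy0 : ζ y = 0
      · simp [hy0, hφ1]
      · have q1 : (φ (ζ y + 1) - φ (ζ y)) ^ 2 ≤ κ ^ 2 := by
          rw [← sq_abs]; exact pow_le_pow_left₀ (abs_nonneg _) (hφ _) 2
        have q2 : (1 : ℝ) ≤ ζ y := by exact_mod_cast Nat.one_le_iff_ne_zero.2 hy0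
        calc h (ζ y) * (φ (ζ y + 1) - φ (ζ y)) ^ 2 ≤ β * κ ^ 2 :=
              mul_le_mul (hβ _) q1 (sq_nonneg _) hβ0.le
          _ = κ ^ 2 * β * 1 := by ring
          _ ≤ _ := mul_le_mul_of_nonneg_left q2 (by positivity)
    calc (∑ y ∈ Λ, h (ζ y) * (F (ζ + dl y) - F ζ) ^ 2) / Hs h Λ ζ
        ≤ (κ ^ 2 * β * (M + 1)) / (α * Λ.card) := by
          refine div_le_div₀ (by positivity) (s1.trans ?_) (by positivity) (hHl ζ)
          refine mul_le_mul_of_nonneg_left (by linarith) (by positivity)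
      _ = _ := by ring
  have d5 : (1 - θ) * b 0 ≤ κ ^ 2 * (β / (α * Λ.card) * (M + 1)) * Z := by linarith
  have d6 : 1 - θ = 1 / (2 * (M + 1)) := by rw [hθ]; ring
  rw [d6] at d5
  have d7 : b 0 = 2 * (M + 1) * (1 / (2 * (M + 1)) * b 0) := by field_simp
  change b 0 ≤ _
  rw [d7, mul_assoc (2 * ((M : ℝ) + 1))]
  exact mul_le_mul_of_nonneg_left d5 (by positivity)

lemma mgf_bound {ι : Type*} (S : Finset ι) (hS : S.Nonempty) (w F : ι → ℝ)
    (hw : ∀ a ∈ S, 0 < w a) (T V : ℝ)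
    (hV : ∀ s, 0 ≤ s → s ≤ T → ∀ m : ℝ, ∑ a ∈ S, w a * Real.exp (s * F a) * (F a - m) = 0 →
      ∑ a ∈ S, w a * Real.exp (s * F a) * (F a - m) ^ 2
        ≤ V * ∑ a ∈ S, w a * Real.exp (s * F a))
    (t : ℝ) (ht : 0 ≤ t) (htT : t ≤ T) :
    Real.log (∑ a ∈ S, w a * Real.exp (t * F a)) - Real.log (∑ a ∈ S, w a)
      ≤ t * ((∑ a ∈ S, w a * F a) / ∑ a ∈ S, w a) + V * t ^ 2 / 2 := by
  set Z : ℝ → ℝ := fun s => ∑ a ∈ S, w a * Real.exp (s * F a) with hZ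
  set A : ℝ → ℝ := fun s => ∑ a ∈ S, w a * Real.exp (s * F a) * F a with hA
  set B : ℝ → ℝ := fun s => ∑ a ∈ S, w a * Real.exp (s * F a) * F a * F a with hB
  have Zpos : ∀ s, 0 < Z s := fun s =>
    Finset.sum_pos (fun a ha => mul_pos (hw a ha) (Real.exp_pos _)) hS
  have de : ∀ a s, HasDerivAt (fun s : ℝ => Real.exp (s * F a)) (Real.exp (s * F a) * F a) s := by
    intro a s
    have := ((hasDerivAt_id s).mul_const (F a)).exp
    simpa using this
  have dZ : ∀ s, HasDerivAt Z (A s) s := by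
    intro s
    have := HasDerivAt.fun_sum (u := S) (fun a _ => (de a s).const_mul (w a))
    simpa only [hA, mul_assoc] using this
  have dA : ∀ s, HasDerivAt A (B s) s := by
    intro s
    have := HasDerivAt.fun_sum (u := S) (fun a _ => ((de a s).const_mul (w a)).mul_const (F a))
    simpa only [hA, hB, mul_assoc] using this
  have dg : ∀ s, HasDerivAt (fun s => V * s - A s / Z s)
      (V * 1 - (B s * Z s - A s * A s) / Z s ^ 2) s := fun s =>
    ((hasDerivAt_id s).const_mul V).sub ((dA s).div (dZ s) (Zpos s).ne')
  have mono : MonotoneOn (fun s => V * s - A s / Z s) (Set.Icc 0 T) := by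
    refine monotoneOn_of_deriv_nonneg (convex_Icc 0 T)
      (fun s _ => (dg s).continuousAt.continuousWithinAt)
      (fun s _ => (dg s).differentiableAt.differentiableWithinAt) ?_
    intro s hs
    rw [interior_Icc] at hs
    rw [(dg s).deriv, mul_one, sub_nonneg, div_le_iff₀ (pow_pos (Zpos s) 2)]
    have h1 : ∀ m : ℝ, ∑ a ∈ S, w a * Real.exp (s * F a) * (F a - m) = A s - m * Z s := by
      intro m
      simp only [hA, hZ]
      rw [Finset.mul_sum, ← Finset.sum_sub_distrib]
      exact Finset.sum_congr rfl fun _ _ => by ring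
    have h2 : ∀ m : ℝ, ∑ a ∈ S, w a * Real.exp (s * F a) * (F a - m) ^ 2
        = B s - 2 * m * A s + m ^ 2 * Z s := by
      intro m
      simp only [hA, hZ, hB]
      rw [Finset.mul_sum, Finset.mul_sum, ← Finset.sum_sub_distrib, ← Finset.sum_add_distrib]
      exact Finset.sum_congr rfl fun _ _ => by ring
    have hz := (Zpos s).ne'
    have h3 := hV s hs.1.le hs.2.le (A s / Z s) (by rw [h1]; field_simp; ring)
    rw [h2] at h3
    have h4 : B s - 2 * (A s / Z s) * A s + (A s / Z s) ^ 2 * Z s = B s - A s * A s / Z s := by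
      field_simp; ring
    rw [h4] at h3
    have h5 := mul_le_mul_of_nonneg_right h3 (Zpos s).le
    have h6 : (B s - A s * A s / Z s) * Z s = B s * Z s - A s * A s := by field_simp
    rw [h6] at h5
    change _ ≤ V * Z s * Z s at h5
    linarith
  set m0 := A 0 / Z 0 with hm0
  have du : ∀ s, HasDerivAt (fun s => V * s ^ 2 / 2 + s * m0 - Real.log (Z s))
      (V * s + m0 - A s / Z s) s := by
    intro s
    have h1 : HasDerivAt (fun s : ℝ => V * s ^ 2 / 2) (V * s) s := by
      have := (((hasDerivAt_id s).pow 2).const_mul V).div_const 2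
      refine this.congr_deriv ?_
      simp; ring
    have h2 : HasDerivAt (fun s : ℝ => s * m0) m0 s := by
      simpa using (hasDerivAt_id s).mul_const m0
    exact (h1.add h2).sub ((dZ s).log (Zpos s).ne')
  have monu : MonotoneOn (fun s => V * s ^ 2 / 2 + s * m0 - Real.log (Z s)) (Set.Icc 0 T) := by
    refine monotoneOn_of_deriv_nonneg (convex_Icc 0 T)
      (fun s _ => (du s).continuousAt.continuousWithinAt)
      (fun s _ => (du s).differentiableAt.differentiableWithinAt) ?_
    intro s hs
    rw [interior_Icc] at hs
    rw [(du s).deriv]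
    have := mono ⟨le_refl 0, hs.1.le.trans hs.2.le⟩ ⟨hs.1.le, hs.2.le⟩ hs.1.le
    simp only at this
    linarith
  have fin := monu ⟨le_refl 0, ht.trans htT⟩ ⟨ht, htT⟩ ht
  have z0 : Z 0 = ∑ a ∈ S, w a := by simp [hZ]
  have a0 : A 0 = ∑ a ∈ S, w a * F a := by simp [hA]
  simp only [z0] at fin
  rw [hm0, z0, a0] at fin
  change Real.log (Z t) - _ ≤ _
  linarith

lemma young (a b : ℝ) (ha : 0 ≤ a) : a * b ≤ a * Real.log a - a + Real.exp b := by
  rcases ha.eq_or_lt with h | h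
  · rw [← h]; simp [(Real.exp_pos b).le]
  · have := Real.log_le_sub_one_of_pos (div_pos (Real.exp_pos b) h)
    rw [Real.log_div (Real.exp_pos b).ne' h.ne', Real.log_exp] at this
    have h2 := mul_le_mul_of_nonneg_left this h.le
    have h3 : a * (Real.exp b / a - 1) = Real.exp b - a := by field_simp
    rw [h3] at h2
    linarith

lemma ent_ineq {ι : Type*} (S : Finset ι) (hS : S.Nonempty) (w f X : ι → ℝ)
    (hw : ∀ a ∈ S, 0 < w a) (hf : ∀ a ∈ S, 0 ≤ f a) (hQ : 0 < ∑ a ∈ S, w a * f a) :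
    ∑ a ∈ S, w a * f a * X a ≤ ∑ a ∈ S, w a * (f a * Real.log (f a))
      - (∑ a ∈ S, w a * f a) * Real.log ((∑ a ∈ S, w a * f a) / ∑ a ∈ S, w a)
      + (∑ a ∈ S, w a * f a) *
        (Real.log (∑ a ∈ S, w a * Real.exp (X a)) - Real.log (∑ a ∈ S, w a)) := by
  set Q := ∑ a ∈ S, w a * f a with hQd
  set M := ∑ a ∈ S, w a * Real.exp (X a) with hMd
  have hM : 0 < M := Finset.sum_pos (fun a ha => mul_pos (hw a ha) (Real.exp_pos _)) hS
  have hZ : 0 < ∑ a ∈ S, w a := Finset.sum_pos hw hS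
  have h1 : ∑ a ∈ S, w a * (f a * (X a - Real.log (M / Q)))
      ≤ ∑ a ∈ S, w a * (f a * Real.log (f a) - f a + Real.exp (X a) * (Q / M)) := by
    refine Finset.sum_le_sum fun a ha => mul_le_mul_of_nonneg_left ?_ (hw a ha).le
    have := young (f a) (X a - Real.log (M / Q)) (hf a ha)
    rw [Real.exp_sub, Real.exp_log (div_pos hM hQ)] at this
    have e : Real.exp (X a) / (M / Q) = Real.exp (X a) * (Q / M) := by field_simp
    rwa [e] at this
  have h2 : ∑ a ∈ S, w a * (f a * (X a - Real.log (M / Q)))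
      = ∑ a ∈ S, w a * f a * X a - Q * Real.log (M / Q) := by
    rw [hQd, Finset.sum_mul, ← Finset.sum_sub_distrib]
    exact Finset.sum_congr rfl fun _ _ => by ring
  have h3 : ∑ a ∈ S, w a * (f a * Real.log (f a) - f a + Real.exp (X a) * (Q / M))
      = ∑ a ∈ S, w a * (f a * Real.log (f a)) - Q + M * (Q / M) := by
    rw [hMd, Finset.sum_mul]
    conv_rhs => rw [hQd]
    rw [← Finset.sum_sub_distrib, ← Finset.sum_add_distrib]
    exact Finset.sum_congr rfl fun _ _ => by ring
  rw [h2, h3, mul_div_cancel₀ _ hM.ne', Real.log_div hM.ne' hQ.ne'] at h1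
  rw [Real.log_div hQ.ne' hZ.ne']
  linarith

/-- Abstract conclusion: small log-mgf gives the covariance bound. -/
lemma cov_abstract {ι : Type*} (S : Finset ι) (hS : S.Nonempty) (w f F : ι → ℝ)
    (hw : ∀ a ∈ S, 0 < w a) (hf : ∀ a ∈ S, 0 ≤ f a) (D B : ℝ) (hD : 0 < D) (hB : 0 ≤ B)
    (hFB : ∀ a ∈ S, |F a| ≤ B)
    (hV : ∀ s, |s| ≤ B / D → ∀ m : ℝ,
      ∑ a ∈ S, w a * Real.exp (s * F a) * (F a - m) = 0 →
      ∑ a ∈ S, w a * Real.exp (s * F a) * (F a - m) ^ 2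
        ≤ 2 * D * ∑ a ∈ S, w a * Real.exp (s * F a)) :
    ((∑ a ∈ S, w a * (f a * F a)) / (∑ a ∈ S, w a)
        - (∑ a ∈ S, w a * f a) / (∑ a ∈ S, w a) * ((∑ a ∈ S, w a * F a) / (∑ a ∈ S, w a))) ^ 2
      ≤ 4 * D * ((∑ a ∈ S, w a * f a) / (∑ a ∈ S, w a)) *
        ((∑ a ∈ S, w a * (f a * Real.log (f a))) / (∑ a ∈ S, w a)
          - (∑ a ∈ S, w a * f a) / (∑ a ∈ S, w a) *
            Real.log ((∑ a ∈ S, w a * f a) / (∑ a ∈ S, w a))) := by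
  have hZ : 0 < ∑ a ∈ S, w a := Finset.sum_pos hw hS
  have hQ0 : 0 ≤ ∑ a ∈ S, w a * f a :=
    Finset.sum_nonneg fun a ha => mul_nonneg (hw a ha).le (hf a ha)
  rcases hQ0.eq_or_lt with hQ | hQ
  · have hz : ∀ a ∈ S, f a = 0 := by
      intro a ha
      have := (Finset.sum_eq_zero_iff_of_nonneg
        (fun a ha => mul_nonneg (hw a ha).le (hf a ha))).1 hQ.symm a ha
      rcases mul_eq_zero.1 this with h | h
      · exact absurd h (hw a ha).ne'
      · exact h
    have h1 : ∑ a ∈ S, w a * (f a * F a) = 0 :=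
      Finset.sum_eq_zero fun a ha => by rw [hz a ha]; ring
    rw [h1, ← hQ]; simp
  set Z := ∑ a ∈ S, w a with hZd
  set Q := ∑ a ∈ S, w a * f a with hQd
  set m0 := (∑ a ∈ S, w a * F a) / Z with hm0
  -- mgf bound both signs
  have mgf : ∀ t, |t| ≤ B / D →
      Real.log (∑ a ∈ S, w a * Real.exp (t * F a)) - Real.log Z ≤ t * m0 + D * t ^ 2 := by
    intro t ht
    rcases le_total 0 t with h | h
    · have := mgf_bound S hS w F hw (B / D) (2 * D)
        (fun s hs hsT m hm => hV s (by rwa [abs_of_nonneg hs]) m hm) t h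
        (by rwa [abs_of_nonneg h] at ht)
      refine this.trans (le_of_eq ?_)
      rw [hm0]; ring
    · have nm : ∀ s x : ℝ, -s * x = s * -x := fun s x => by ring
      have this := mgf_bound S hS w (fun a => - F a) hw (B / D) (2 * D) (by
        intro s hs hsT m hm
        have h2 := hV (-s) (by rwa [abs_neg, abs_of_nonneg hs]) (-m) (by
          rw [← neg_eq_zero, ← hm, ← Finset.sum_neg_distrib]
          refine Finset.sum_congr rfl fun a _ => ?_
          rw [nm]; ring)
        have e1 : ∑ a ∈ S, w a * Real.exp (-s * F a) * (F a - -m) ^ 2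
            = ∑ a ∈ S, w a * Real.exp (s * -F a) * (-F a - m) ^ 2 :=
          Finset.sum_congr rfl fun a _ => by rw [nm]; ring
        have e2 : ∑ a ∈ S, w a * Real.exp (-s * F a) = ∑ a ∈ S, w a * Real.exp (s * -F a) :=
          Finset.sum_congr rfl fun a _ => by rw [nm]
        rw [e1, e2] at h2
        exact h2) (-t) (by linarith) (by rwa [abs_of_nonpos h] at ht)
      simp only [neg_mul_neg] at this
      refine this.trans (le_of_eq ?_)
      simp only [mul_neg, Finset.sum_neg_distrib]
      rw [hm0]; ring
  set Cv := (∑ a ∈ S, w a * (f a * F a)) / Z - Q / Z * m0 with hCv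
  set E := (∑ a ∈ S, w a * (f a * Real.log (f a))) / Z - Q / Z * Real.log (Q / Z) with hE
  have hm : 0 < Q / Z := div_pos hQ hZ
  have main : ∀ t, |t| ≤ B / D → t * Cv ≤ E + Q / Z * (D * t ^ 2) := by
    intro t ht
    have h1 := ent_ineq S hS w f (fun a => t * F a) hw hf hQ
    have h2 := mul_le_mul_of_nonneg_left (mgf t ht) hQ.le
    have h3 : ∑ a ∈ S, w a * f a * (t * F a) = t * ∑ a ∈ S, w a * (f a * F a) := by
      rw [Finset.mul_sum]; exact Finset.sum_congr rfl fun _ _ => by ring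
    rw [h3] at h1
    have h4 : t * ∑ a ∈ S, w a * (f a * F a) ≤ ∑ a ∈ S, w a * (f a * Real.log (f a))
        - Q * Real.log (Q / Z) + Q * (t * m0 + D * t ^ 2) := by
      simp only [← hQd, ← hZd] at h1
      linarith
    have h5 := div_le_div_of_nonneg_right h4 hZ.le
    have e1 : t * Cv = t * (∑ a ∈ S, w a * (f a * F a)) / Z - Q / Z * (t * m0) := by
      rw [hCv]; ring
    have e2 : (∑ a ∈ S, w a * (f a * Real.log (f a))
        - Q * Real.log (Q / Z) + Q * (t * m0 + D * t ^ 2)) / Z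
        = E + Q / Z * (D * t ^ 2) + Q / Z * (t * m0) := by rw [hE]; ring
    rw [e2] at h5
    rw [e1]; linarith
  have b1 : |∑ a ∈ S, w a * (f a * F a)| ≤ B * Q := by
    refine (Finset.abs_sum_le_sum_abs _ _).trans ?_
    rw [hQd, Finset.mul_sum]
    refine Finset.sum_le_sum fun a ha => ?_
    rw [abs_mul, abs_mul, abs_of_pos (hw a ha), abs_of_nonneg (hf a ha)]
    have := mul_le_mul_of_nonneg_left (hFB a ha) (mul_nonneg (hw a ha).le (hf a ha))
    linarith
  have b2 : |m0| ≤ B := by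
    rw [hm0, abs_div, abs_of_pos hZ, div_le_iff₀ hZ]
    refine (Finset.abs_sum_le_sum_abs _ _).trans ?_
    rw [hZd, Finset.mul_sum]
    refine Finset.sum_le_sum fun a ha => ?_
    rw [abs_mul, abs_of_pos (hw a ha), mul_comm]
    exact mul_le_mul_of_nonneg_right (hFB a ha) (hw a ha).le
  have b3 : |Cv| ≤ 2 * B * (Q / Z) := by
    rw [hCv]
    refine (abs_sub _ _).trans ?_
    rw [abs_div, abs_of_pos hZ, abs_mul, abs_of_pos hm]
    have q1 : |∑ a ∈ S, w a * (f a * F a)| / Z ≤ B * Q / Z :=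
      div_le_div_of_nonneg_right b1 hZ.le
    have q2 := mul_le_mul_of_nonneg_left b2 hm.le
    have q3 : B * Q / Z = B * (Q / Z) := by ring
    linarith
  have fin := main (Cv / (2 * D * (Q / Z))) (by
    rw [abs_div, abs_of_pos (by positivity : 0 < 2 * D * (Q / Z)),
      div_le_div_iff₀ (by positivity) hD]
    have := mul_le_mul_of_nonneg_right b3 hD.le
    linarith)
  set q := Q / Z with hq
  have f1 : Cv / (2 * D * q) * Cv - q * (D * (Cv / (2 * D * q)) ^ 2) = Cv ^ 2 / (4 * D * q) := by
    field_simp; ring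
  have f2 : Cv ^ 2 / (4 * D * q) ≤ E := by rw [← f1]; linarith
  rw [div_le_iff₀ (by positivity)] at f2
  linarith

lemma c_lower (c : ℕ → ℝ) (a₂ : ℝ) (k₀ : ℕ)
    (hc0 : c 0 = 0) (hcpos : ∀ n : ℕ, 0 < n → 0 < c n)
    (hk₀ : 0 < k₀) (ha₂ : 0 < a₂)
    (hM : ∀ j k : ℕ, j + k₀ ≤ k → a₂ ≤ c k - c j) :
    ∃ α₀ : ℝ, 0 < α₀ ∧ ∀ n : ℕ, α₀ * n ≤ c n := by
  have hne : (Finset.Icc 1 k₀).Nonempty := ⟨1, by simp; omega⟩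
  obtain ⟨i, hi, hmin⟩ := Finset.exists_min_image (Finset.Icc 1 k₀) c hne
  have hi0 : 0 < c i := hcpos i (by simp at hi; omega)
  have hk : (0 : ℝ) < k₀ := by exact_mod_cast hk₀
  set m := min (c i) a₂ with hm
  have hm0 : 0 < m := lt_min hi0 ha₂
  refine ⟨m / k₀, div_pos hm0 hk, ?_⟩
  intro n
  induction n using Nat.strong_induction_on with
  | _ n ih =>
    rcases Nat.eq_zero_or_pos n with h0 | h0
    · subst h0; simp [hc0]
    · by_cases hn : n ≤ k₀
      · have h1 : c i ≤ c n := hmin n (by simp; omega)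
        have h2 : (n : ℝ) ≤ k₀ := by exact_mod_cast hn
        calc m / k₀ * n ≤ m / k₀ * k₀ := mul_le_mul_of_nonneg_left h2 (by positivity)
          _ = m := by field_simp
          _ ≤ c i := min_le_left _ _
          _ ≤ c n := h1
      · have h1 := ih (n - k₀) (by omega)
        have h2 := hM (n - k₀) n (by omega)
        rw [Nat.cast_sub (by omega)] at h1
        have h3 : m / k₀ * ((n : ℝ) - k₀) = m / k₀ * n - m := by field_simp
        have h4 : m ≤ a₂ := min_le_right _ _
        linarith

lemma wE_nuW (c : ℕ → ℝ) (Λ : Finset ℤ) (N : ℕ) (f : (ℤ → ℕ) → ℝ) :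
    wE (nuW c Λ N) f = (∑ η ∈ XX Λ N, Wt (fun n => (cfact c n)⁻¹) Λ η * f η)
      / ∑ η ∈ XX Λ N, Wt (fun n => (cfact c n)⁻¹) Λ η := by
  have hin : ∀ η ∈ XX Λ N, nuW c Λ N η = Wt (fun n => (cfact c n)⁻¹) Λ η := by
    intro η hη
    rw [mem_XX] at hη
    rw [nuW, Set.indicator_of_mem]
    · rfl
    · refine ⟨fun x hx => ?_, hη.1⟩
      by_contra h
      exact hx (hη.2 x h)
  have hout : ∀ η ∉ XX Λ N, nuW c Λ N η = 0 := by
    intro η hη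
    rw [nuW, Set.indicator_of_notMem]
    rintro ⟨h1, h2⟩
    apply hη
    rw [mem_XX]
    refine ⟨h2, fun i hi => ?_⟩
    by_contra h
    exact hi (h1 i h)
  rw [wE, tsum_eq_sum (s := XX Λ N) (fun η hη => by rw [hout η hη, zero_mul]),
    tsum_eq_sum (s := XX Λ N) hout, Finset.sum_congr rfl hin]
  congr 1
  exact Finset.sum_congr rfl fun η hη => by rw [hin η hη]

/-- Lemma 4.4: the covariance estimate for small density `N/L ≤ ρ₀`. -/
theorem statement18
    (c : ℕ → ℝ) (a₁ a₂ : ℝ) (k₀ : ℕ)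
    (hc0 : c 0 = 0) (hcpos : ∀ n : ℕ, 0 < n → 0 < c n)
    (hLG : ∀ k : ℕ, |c (k + 1) - c k| ≤ a₁)
    (hk₀ : 0 < k₀) (ha₂ : 0 < a₂)
    (hM : ∀ j k : ℕ, j + k₀ ≤ k → a₂ ≤ c k - c j)
    (ε : ℝ) (hε : 0 < ε) :
    ∃ ρ₀ Cε : ℝ, 0 < ρ₀ ∧ 0 < Cε ∧ ∀ (a : ℤ) (L N : ℕ), 1 ≤ L → 1 ≤ N →
      (N : ℝ) / (L : ℝ) ≤ ρ₀ →
      ∀ f : (ℤ → ℕ) → ℝ, (∀ η, 0 ≤ f η) →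
        (wCov (nuW c (Finset.Ico a (a + (L : ℤ))) N) f
            (fun η => ∑ x ∈ Finset.Ico a (a + (L : ℤ)), c (η x))) ^ 2
          ≤ (N : ℝ) * wE (nuW c (Finset.Ico a (a + (L : ℤ))) N) f *
              (Cε * wE (nuW c (Finset.Ico a (a + (L : ℤ))) N) f
                + ε * wEnt (nuW c (Finset.Ico a (a + (L : ℤ))) N) f) := by
  obtain ⟨α₀, hα₀, hcl⟩ := c_lower c a₂ k₀ hc0 hcpos hk₀ ha₂ hM
  have hc1 : c 1 ≤ a₁ := by
    have := hLG 0
    rw [zero_add, hc0, sub_zero] at this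
    exact (le_abs_self _).trans this
  have hc1pos : 0 < c 1 := hcpos 1 one_pos
  have ha1 : 0 < a₁ := hc1pos.trans_le hc1
  have hcu : ∀ n : ℕ, c n ≤ a₁ * n := by
    intro n
    induction n with
    | zero => simp [hc0]
    | succ n ih =>
      have := (le_abs_self _).trans (hLG n)
      push_cast
      linarith
  set κ : ℝ := 2 * a₁ with hκ
  have hκ0 : 0 < κ := by positivity
  set φ : ℕ → ℝ := fun n => c n - c 1 * n with hφd
  have hφ0 : φ 0 = 0 := by simp [hφd, hc0]
  have hφ1 : φ 1 = 0 := by simp [hφd]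
  have hφ : ∀ n, |φ (n + 1) - φ n| ≤ κ := by
    intro n
    have e : φ (n + 1) - φ n = (c (n + 1) - c n) - c 1 := by
      simp only [hφd]; push_cast; ring
    rw [e]
    refine (abs_sub _ _).trans ?_
    rw [abs_of_pos hc1pos]
    linarith [hLG n]
  have hφb : ∀ n : ℕ, |φ n| ≤ κ * n := by
    intro n
    induction n with
    | zero => simp [hφ0]
    | succ n ih =>
      have h1 := abs_sub_abs_le_abs_sub (φ (n + 1)) (φ n)
      have := hφ n
      push_cast
      linarith
  set T : ℝ := 4 * κ / ε with hT
  set α : ℝ := Real.exp (-(T * κ)) / a₁ with hα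
  set β : ℝ := Real.exp (T * κ) / α₀ with hβ
  have hα0 : 0 < α := by positivity
  have hβ0 : 0 < β := by positivity
  refine ⟨min (α / (4 * β)) (ε / 4 * α / (κ ^ 2 * β)), 1, by positivity, one_pos, ?_⟩
  intro a L N hL hN hρ f hf
  obtain ⟨M, rfl⟩ : ∃ M, N = M + 1 := ⟨N - 1, by omega⟩
  set Λ := Finset.Ico a (a + (L : ℤ)) with hΛ
  have hcard : Λ.card = L := by simp [hΛ]
  have hLpos : (0 : ℝ) < L := by exact_mod_cast hL
  have hρ1 : ((M : ℝ) + 1) / L ≤ α / (4 * β) := by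
    have := hρ.trans (min_le_left _ _); push_cast at this; exact this
  have hρ2 : ((M : ℝ) + 1) / L ≤ ε / 4 * α / (κ ^ 2 * β) := by
    have := hρ.trans (min_le_right _ _); push_cast at this; exact this
  have hden : 2 * β / (α * Λ.card) * (M + 1) ≤ 1 / 2 := by
    rw [hcard]
    calc 2 * β / (α * L) * (M + 1) = 2 * β / α * (((M : ℝ) + 1) / L) := by field_simp
      _ ≤ 2 * β / α * (α / (4 * β)) := mul_le_mul_of_nonneg_left hρ1 (by positivity)
      _ = 1 / 2 := by field_simp; norm_num
  have hvar : κ ^ 2 * (β / (α * Λ.card) * (M + 1)) ≤ ε / 4 := by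
    rw [hcard]
    calc κ ^ 2 * (β / (α * L) * (M + 1)) = κ ^ 2 * β / α * (((M : ℝ) + 1) / L) := by field_simp
      _ ≤ κ ^ 2 * β / α * (ε / 4 * α / (κ ^ 2 * β)) :=
          mul_le_mul_of_nonneg_left hρ2 (by positivity)
      _ = ε / 4 := by field_simp
  have hcf : ∀ n, 0 < cfact c n := by
    intro n
    induction n with
    | zero => simp [cfact]
    | succ n ih => rw [cfact]; exact mul_pos ih (hcpos _ (Nat.succ_pos _))
  set p0 : ℕ → ℝ := fun n => (cfact c n)⁻¹ with hp0d
  have hp0 : ∀ n, 0 < p0 n := fun n => inv_pos.2 (hcf n)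
  set F : (ℤ → ℕ) → ℝ := fun η => ∑ x ∈ Λ, φ (η x) with hF
  have hne : (XX Λ (M + 1)).Nonempty := by
    refine ⟨Pi.single a (M + 1), mem_XX.2 ⟨?_, ?_⟩⟩
    · have haΛ : a ∈ Λ := by simp [hΛ]; omega
      simp [Finset.sum_pi_single', haΛ]
    · intro i hi
      have : i = a := by
        by_contra h
        simp [h] at hi
      rw [this]; simp [hΛ]; omega
  have hFB : ∀ η ∈ XX Λ (M + 1), |F η| ≤ κ * (M + 1) := by
    intro η hη
    have hsum : ∑ z ∈ Λ, (η z : ℝ) = M + 1 := by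
      rw [← Nat.cast_sum, (mem_XX.1 hη).1]; push_cast; rfl
    refine (Finset.abs_sum_le_sum_abs _ _).trans ?_
    rw [← hsum, Finset.mul_sum]
    exact Finset.sum_le_sum fun x _ => hφb _
  have hM1 : (0 : ℝ) < M + 1 := by positivity
  have key := cov_abstract (XX Λ (M + 1)) hne (Wt p0 Λ) f F (fun η _ => Wt_pos p0 hp0 Λ η)
    (fun η _ => hf η) (ε / 4 * (M + 1)) (κ * (M + 1)) (by positivity) (by positivity) hFB (by
      intro s hs m hm
      have hsT : |s| ≤ T := by
        refine hs.trans (le_of_eq ?_)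
        rw [hT]; field_simp
      set p : ℕ → ℝ := fun n => p0 n * Real.exp (s * φ n) with hp
      have hppos : ∀ n, 0 < p n := fun n => mul_pos (hp0 n) (Real.exp_pos _)
      set h : ℕ → ℝ := fun n => (n + 1) / c (n + 1) * Real.exp (s * (φ (n + 1) - φ n)) with hh
      have hhp : ∀ n : ℕ, h n * p n = (n + 1) * p (n + 1) := by
        intro n
        have e1 : Real.exp (s * φ (n + 1))
            = Real.exp (s * (φ (n + 1) - φ n)) * Real.exp (s * φ n) := by
          rw [← Real.exp_add]; congr 1; ring
        have e2 : p0 (n + 1) = p0 n * (c (n + 1))⁻¹ := by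
          simp only [hp0d, cfact, mul_inv]
        simp only [hh, hp]
        rw [e1, e2]
        ring
      have hexp : ∀ n, |s * (φ (n + 1) - φ n)| ≤ T * κ := by
        intro n
        rw [abs_mul]
        exact mul_le_mul hsT (hφ n) (abs_nonneg _) ((abs_nonneg _).trans hsT)
      have hαh : ∀ n, α ≤ h n := by
        intro n
        have hcn := hcpos (n + 1) (Nat.succ_pos n)
        have h1 : 1 / a₁ ≤ ((n : ℝ) + 1) / c (n + 1) := by
          rw [div_le_div_iff₀ ha1 hcn]
          have := hcu (n + 1); push_cast at this; linarith
        have h2 : Real.exp (-(T * κ)) ≤ Real.exp (s * (φ (n + 1) - φ n)) :=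
          Real.exp_le_exp.2 (abs_le.1 (hexp n)).1
        calc α = 1 / a₁ * Real.exp (-(T * κ)) := by rw [hα]; ring
          _ ≤ h n := mul_le_mul h1 h2 (Real.exp_pos _).le (by positivity)
      have hβh : ∀ n, h n ≤ β := by
        intro n
        have hcn := hcpos (n + 1) (Nat.succ_pos n)
        have h1 : ((n : ℝ) + 1) / c (n + 1) ≤ 1 / α₀ := by
          rw [div_le_div_iff₀ hcn hα₀]
          have := hcl (n + 1); push_cast at this; linarith
        have h2 : Real.exp (s * (φ (n + 1) - φ n)) ≤ Real.exp (T * κ) :=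
          Real.exp_le_exp.2 (abs_le.1 (hexp n)).2
        calc h n ≤ 1 / α₀ * Real.exp (T * κ) :=
              mul_le_mul h1 h2 (Real.exp_pos _).le (by positivity)
          _ = β := by rw [hβ]; ring
      have hW : ∀ η, Wt p Λ η = Wt p0 Λ η * Real.exp (s * F η) := by
        intro η
        simp only [Wt, hp, hF]
        rw [Finset.prod_mul_distrib, Finset.mul_sum, Real.exp_sum]
      have vb := var_bound p h hppos hhp α β hα0 hαh hβh Λ (by omega) M hden φ κ
        (by rw [hφ0, hφ1]) hφ m (by
          rw [← hm]
          simp only [ip, mul_one, hW]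
          rfl)
      have l1 : ∑ η ∈ XX Λ (M + 1), Wt p0 Λ η * Real.exp (s * F η) * (F η - m) ^ 2
          = ip p Λ (M + 1) (fun η => ∑ x ∈ Λ, φ (η x) - m) (fun η => ∑ x ∈ Λ, φ (η x) - m) := by
        simp only [ip, hW]
        exact Finset.sum_congr rfl fun η _ => by simp only [hF]; ring
      have l2 : ip p Λ (M + 1) (fun _ => 1) (fun _ => 1)
          = ∑ η ∈ XX Λ (M + 1), Wt p0 Λ η * Real.exp (s * F η) := by
        simp only [ip, mul_one, hW]
      rw [l1, ← l2]
      refine vb.trans ?_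
      refine mul_le_mul_of_nonneg_right ?_ ?_
      · have := mul_le_mul_of_nonneg_left hvar (by positivity : (0 : ℝ) ≤ 2 * (M + 1))
        linarith
      · rw [l2]
        exact Finset.sum_nonneg fun η _ => mul_nonneg (Wt_pos p0 hp0 Λ η).le (Real.exp_pos _).le)
  have hZ : 0 < ∑ η ∈ XX Λ (M + 1), Wt p0 Λ η :=
    Finset.sum_pos (fun η _ => Wt_pos p0 hp0 Λ η) hne
  have hGF : ∀ η ∈ XX Λ (M + 1), ∑ x ∈ Λ, c (η x) = F η + c 1 * (M + 1) := by
    intro η hη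
    have hsum : ∑ z ∈ Λ, (η z : ℝ) = M + 1 := by
      rw [← Nat.cast_sum, (mem_XX.1 hη).1]; push_cast; rfl
    simp only [hF, hφd]
    rw [Finset.sum_sub_distrib, ← Finset.mul_sum, hsum]; ring
  have hcov : wCov (nuW c Λ (M + 1)) f (fun η => ∑ x ∈ Λ, c (η x))
      = (∑ η ∈ XX Λ (M + 1), Wt p0 Λ η * (f η * F η)) / (∑ η ∈ XX Λ (M + 1), Wt p0 Λ η)
        - (∑ η ∈ XX Λ (M + 1), Wt p0 Λ η * f η) / (∑ η ∈ XX Λ (M + 1), Wt p0 Λ η)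
          * ((∑ η ∈ XX Λ (M + 1), Wt p0 Λ η * F η) / (∑ η ∈ XX Λ (M + 1), Wt p0 Λ η)) := by
    rw [wCov, wE_nuW, wE_nuW, wE_nuW]
    have s1 : ∑ η ∈ XX Λ (M + 1), Wt p0 Λ η * (f η * ∑ x ∈ Λ, c (η x))
        = ∑ η ∈ XX Λ (M + 1), Wt p0 Λ η * (f η * F η)
          + c 1 * (M + 1) * ∑ η ∈ XX Λ (M + 1), Wt p0 Λ η * f η := by
      rw [Finset.mul_sum, ← Finset.sum_add_distrib]
      exact Finset.sum_congr rfl fun η hη => by rw [hGF η hη]; ring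
    have s2 : ∑ η ∈ XX Λ (M + 1), Wt p0 Λ η * ∑ x ∈ Λ, c (η x)
        = ∑ η ∈ XX Λ (M + 1), Wt p0 Λ η * F η
          + c 1 * (M + 1) * ∑ η ∈ XX Λ (M + 1), Wt p0 Λ η := by
      rw [Finset.mul_sum, ← Finset.sum_add_distrib]
      exact Finset.sum_congr rfl fun η hη => by rw [hGF η hη]; ring
    rw [← hp0d, s1, s2]
    have hz := hZ.ne'
    generalize ∑ η ∈ XX Λ (M + 1), Wt p0 Λ η = Z at hz ⊢
    field_simp
    ring
  rw [hcov, wEnt, wE_nuW, wE_nuW]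
  refine key.trans ?_
  rw [one_mul]
  push_cast
  have hm0 : 0 ≤ (∑ η ∈ XX Λ (M + 1), Wt p0 Λ η * f η) / ∑ η ∈ XX Λ (M + 1), Wt p0 Λ η :=
    div_nonneg (Finset.sum_nonneg fun η _ => mul_nonneg (Wt_pos p0 hp0 Λ η).le (hf η)) hZ.le
  rw [← hp0d]
  have hq := mul_nonneg hM1.le (mul_self_nonneg
    ((∑ η ∈ XX Λ (M + 1), Wt p0 Λ η * f η) / ∑ η ∈ XX Λ (M + 1), Wt p0 Λ η))
  linarith
end
end

section
/- For every N₀ ∈ ℕ∖{0} there exists a finite constant A₀ such that for every finite Λ ⊂ ℤ^d, sup over integers 0 < n ≤ N ≤ N₀ of | p_Λ^{N/|Λ|}(n) − (N^n/n!) e^{−N} | ≤ A₀/|Λ|, where p_Λ^ρ(n) := μ_ρ[ Σ_{x∈Λ} η_x = n ]. -/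
open scoped BigOperators

noncomputable section

/-- The configuration obtained from `η` by moving one particle from `x` to `y` (`x ≠ y`),
i.e. `η - δ^x + δ^y`. -/
def moved (d : ℕ) (η : (Fin d → ℤ) → ℕ) (x y : Fin d → ℤ) : (Fin d → ℤ) → ℕ :=
  fun z => if z = x then η x - 1 else if z = y then η y + 1 else η z

/-- Unnormalized weight of the canonical measure `ν_Λ^N` on configurations supported in
`Λ ⊂ ℤ^d` with `N` particles: `∏_{x∈Λ} 1/c(η_x)!`. -/
def nuWd (d : ℕ) (c : ℕ → ℝ) (Λ : Finset (Fin d → ℤ)) (N : ℕ) : ((Fin d → ℤ) → ℕ) → ℝ :=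
  Set.indicator {η : (Fin d → ℤ) → ℕ | (∀ x, x ∉ Λ → η x = 0) ∧ (∑ x ∈ Λ, η x) = N}
    (fun η => ∏ x ∈ Λ, (cfact c (η x))⁻¹)

/-- Expectation with respect to the probability measure obtained by normalizing the
nonnegative weight `w`. -/
def wEd (d : ℕ) (w f : ((Fin d → ℤ) → ℕ) → ℝ) : ℝ :=
  (∑' η : (Fin d → ℤ) → ℕ, w η * f η) / (∑' η : (Fin d → ℤ) → ℕ, w η)

/-- Entropy `Ent_μ(f) = μ[f log f] - μ[f] log μ[f]` (note `Real.log 0 = 0`, giving the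
convention `0 log 0 = 0`). -/
def wEntd (d : ℕ) (w f : ((Fin d → ℤ) → ℕ) → ℝ) : ℝ :=
  wEd d w (fun η => f η * Real.log (f η)) - wEd d w f * Real.log (wEd d w f)

/-- Dirichlet form of the zero-range process on `Λ ⊂ ℤ^d`:
`E(f,g) = (1/2) Σ_{x∈Λ} Σ_{y∈Λ, |x-y|=1} μ[c(η_x) ∂_{xy}f ∂_{xy}g]`. -/
def wDird (d : ℕ) (c : ℕ → ℝ) (Λ : Finset (Fin d → ℤ))
    (w f g : ((Fin d → ℤ) → ℕ) → ℝ) : ℝ :=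
  wEd d w (fun η => (1 / 2) * ∑ x ∈ Λ, ∑ y ∈ Λ,
    if (∑ i, (x i - y i).natAbs) = 1 then
      c (η x) * ((f (moved d η x y) - f η) * (g (moved d η x y) - g η)) else 0)

/-- Grand canonical partition function `Z(α) = Σ_k α^k / c(k)!`. -/
def Zfun (c : ℕ → ℝ) (α : ℝ) : ℝ := ∑' k : ℕ, α ^ k / cfact c k

/-- Mean particle number per site under the grand canonical measure with fugacity `α`. -/
def meanGC (c : ℕ → ℝ) (α : ℝ) : ℝ :=
  (∑' k : ℕ, (k : ℝ) * α ^ k / cfact c k) / Zfun c α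

/-- `p_Λ^α(n) = μ_α[Σ_{x∈Λ} η_x = n]`, written for the grand canonical product measure on
`ℕ^Λ` with fugacity `α`. -/
def pLam (d : ℕ) (c : ℕ → ℝ) (α : ℝ) (Λ : Finset (Fin d → ℤ)) (n : ℕ) : ℝ :=
  (∑' η : (Fin d → ℤ) → ℕ,
      Set.indicator {η : (Fin d → ℤ) → ℕ | (∀ x, x ∉ Λ → η x = 0) ∧ (∑ x ∈ Λ, η x) = n}
        (fun η => ∏ x ∈ Λ, α ^ η x / cfact c (η x)) η) /
    (Zfun c α) ^ Λ.card

open PowerSeries in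
lemma zr_recur (u : ℕ → ℝ) (hu0 : u 0 = 1) (V : ℕ) (hV : 1 ≤ V) (m : ℕ) :
    ((m : ℝ) + 1) * coeff (m + 1) ((PowerSeries.mk u) ^ V) =
      ∑ i ∈ Finset.range (m + 1), ((V : ℝ) * (i + 1) - ((m : ℝ) - i)) * u (i + 1) *
        coeff (m - i) ((PowerSeries.mk u) ^ V) := by
  set U := PowerSeries.mk u with hU
  set A := U ^ V with hA
  have h1 : U * (derivative ℝ A) = (V : ℝ⟦X⟧) * ((derivative ℝ U) * A) := by
    rw [hA, Derivation.leibniz_pow]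
    obtain ⟨W, rfl⟩ : ∃ W, V = W + 1 := ⟨V - 1, by omega⟩
    simp only [nsmul_eq_mul, smul_eq_mul, Nat.add_sub_cancel]
    ring
  have h2 := congrArg (coeff m) h1
  have hc : (V : ℝ⟦X⟧) = C (V : ℝ) := by simp
  rw [hc, coeff_C_mul, coeff_mul, coeff_mul,
    Finset.Nat.sum_antidiagonal_eq_sum_range_succ_mk,
    Finset.Nat.sum_antidiagonal_eq_sum_range_succ_mk, Finset.sum_range_succ'] at h2
  simp only [coeff_derivative, hU, coeff_mk] at h2
  have h3 : ∑ i ∈ Finset.range (m + 1), ((m : ℝ) - i) * u (i + 1) * coeff (m - i) A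
      = ∑ k ∈ Finset.range m,
        u (k + 1) * ((coeff (m - (k + 1) + 1)) A * (((m - (k + 1) : ℕ) : ℝ) + 1)) := by
    rw [Finset.sum_range_succ]
    simp only [sub_self, zero_mul, add_zero]
    refine Finset.sum_congr rfl fun k hk => ?_
    have hk' := Finset.mem_range.mp hk
    have e : m - (k + 1) + 1 = m - k := by omega
    have e2 : (((m - (k + 1) : ℕ) : ℝ) + 1) = (m : ℝ) - k := by
      have : ((m - (k + 1) + 1 : ℕ) : ℝ) = ((m - k : ℕ) : ℝ) := by rw [e]
      push_cast at this
      rw [this, Nat.cast_sub hk'.le]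
    rw [e, e2]; ring
  rw [← h3, hu0, Finset.mul_sum] at h2
  simp only [Nat.sub_zero, one_mul] at h2
  have h4 : ∑ i ∈ Finset.range (m + 1), ((V : ℝ) * (i + 1) - ((m : ℝ) - i)) * u (i + 1) *
        coeff (m - i) A = ∑ i ∈ Finset.range (m + 1), (V : ℝ) * (u (i + 1) * (i + 1) * coeff (m - i) A)
        - ∑ i ∈ Finset.range (m + 1), ((m : ℝ) - i) * u (i + 1) * coeff (m - i) A := by
    rw [← Finset.sum_sub_distrib]
    refine Finset.sum_congr rfl fun k hk => ?_
    ring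
  rw [h4, ← h2]; ring

open PowerSeries in
lemma zr_coeff (K : ℝ) (hK : 0 ≤ K) (n : ℕ) : ∃ C : ℝ, 0 ≤ C ∧ ∀ (u : ℕ → ℝ) (V : ℕ), 1 ≤ V →
    u 0 = 1 → (∀ k, 0 ≤ u k) → (∀ k, u k ≤ (K / V) ^ k) →
    |coeff n ((PowerSeries.mk u) ^ V) - ((V : ℝ) * u 1) ^ n / (n.factorial : ℝ)| ≤ C / V := by
  induction n using Nat.strong_induction_on with
  | _ n ih =>
  rcases n with _ | m
  · refine ⟨0, le_rfl, fun u V hV hu0 _ _ => ?_⟩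
    simp [hu0]
  choose! C hC0 hC using ih
  set B : ℕ → ℝ := fun k => C k + K ^ k with hB
  refine ⟨K * C m + m * K * B m + ∑ j ∈ Finset.range m, ((j : ℝ) + 2 + m) * K ^ (j + 2) * B (m - (j + 1)),
    ?_, ?_⟩
  · have := hC0 m (by omega)
    have hBn : ∀ k, k < m + 1 → 0 ≤ B k := fun k hk => by
      have := hC0 k hk
      simp only [hB]; positivity
    have := hBn m (by omega)
    have : 0 ≤ ∑ j ∈ Finset.range m, ((j : ℝ) + 2 + m) * K ^ (j + 2) * B (m - (j + 1)) :=
      Finset.sum_nonneg fun j hj => by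
        have := hBn (m - (j + 1)) (by omega)
        positivity
    positivity
  intro u V hV hu0 hun huK
  have hV1 : (1 : ℝ) ≤ V := by exact_mod_cast hV
  have hVp : (0 : ℝ) < V := by linarith
  set a : ℕ → ℝ := fun k => coeff k ((PowerSeries.mk u) ^ V) with ha
  set lam : ℝ := V * u 1 with hlam
  have hu1 : u 1 ≤ K / V := by simpa using huK 1
  have hlam0 : 0 ≤ lam := mul_nonneg hVp.le (hun 1)
  have hlamK : lam ≤ K := by
    rw [hlam]; rw [le_div_iff₀ hVp] at hu1; linarith
  have hab : ∀ k, k < m + 1 → |a k| ≤ B k := by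
    intro k hk
    have h1 := hC k hk u V hV hu0 hun huK
    have h2 : C k / V ≤ C k := div_le_self (hC0 k hk) hV1
    have h3 : |lam ^ k / (k.factorial : ℝ)| ≤ K ^ k := by
      rw [abs_of_nonneg (by positivity)]
      refine (div_le_self (by positivity) (by exact_mod_cast k.factorial_pos)).trans ?_
      exact pow_le_pow_left₀ hlam0 hlamK k
    have h4 := abs_sub_abs_le_abs_sub (a k) (lam ^ k / (k.factorial : ℝ))
    simp only [hB]
    change |a k - _| ≤ _ at h1
    linarith
  have hrec := zr_recur u hu0 V hV m
  rw [Finset.sum_range_succ'] at hrec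
  have key : ((m : ℝ) + 1) * (a (m + 1) - lam ^ (m + 1) / ((m + 1).factorial : ℝ)) =
      lam * (a m - lam ^ m / (m.factorial : ℝ)) + (- (m * u 1 * a m)) +
      ∑ j ∈ Finset.range m, ((V : ℝ) * (j + 2) - ((m : ℝ) - (j + 1))) * u (j + 2) * a (m - (j + 1)) := by
    have hf : ((m : ℝ) + 1) * (lam ^ (m + 1) / ((m + 1).factorial : ℝ)) = lam * (lam ^ m / (m.factorial : ℝ)) := by
      rw [Nat.factorial_succ]
      have : (m.factorial : ℝ) ≠ 0 := by positivity
      push_cast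
      field_simp
      ring
    have hs : ∑ j ∈ Finset.range m, ((V : ℝ) * (j + 2) - ((m : ℝ) - (j + 1))) * u (j + 2) * a (m - (j + 1))
      = ∑ k ∈ Finset.range m, ((V : ℝ) * (((k + 1 : ℕ) : ℝ) + 1) - ((m : ℝ) - ((k + 1 : ℕ) : ℝ))) * u (k + 1 + 1) *
        coeff (m - (k + 1)) ((PowerSeries.mk u) ^ V) := by
      refine Finset.sum_congr rfl fun k hk => ?_
      push_cast
      simp only [ha]
      ring_nf
    rw [hs, mul_sub, hf]
    simp only [ha]
    rw [hrec]
    simp only [Nat.cast_zero, Nat.sub_zero, zero_add, hlam]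
    ring
  have hm1 : (1 : ℝ) ≤ (m : ℝ) + 1 := by have : (0 : ℝ) ≤ m := by positivity
                                         linarith
  have hle : |a (m + 1) - lam ^ (m + 1) / ((m + 1).factorial : ℝ)| ≤
      |((m : ℝ) + 1) * (a (m + 1) - lam ^ (m + 1) / ((m + 1).factorial : ℝ))| := by
    rw [abs_mul, abs_of_nonneg (by linarith : (0 : ℝ) ≤ (m : ℝ) + 1)]
    exact le_mul_of_one_le_left (abs_nonneg _) hm1
  refine hle.trans ?_
  rw [key, add_div, add_div]
  refine (abs_add_le _ _).trans (add_le_add ((abs_add_le _ _).trans (add_le_add ?_ ?_)) ?_)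
  · rw [abs_mul, abs_of_nonneg hlam0, mul_div_assoc]
    exact mul_le_mul hlamK (hC m (by omega) u V hV hu0 hun huK) (abs_nonneg _) hK
  · rw [abs_neg, abs_mul, abs_of_nonneg (mul_nonneg (by positivity) (hun 1))]
    have : (m : ℝ) * K * B m / V = (m * (K / V)) * B m := by ring
    rw [this]
    have := hab m (by omega)
    have h0 := abs_nonneg (a m)
    gcongr
  · rw [Finset.sum_div]
    refine (Finset.abs_sum_le_sum_abs _ _).trans (Finset.sum_le_sum fun j hj => ?_)
    have hj' := Finset.mem_range.mp hj
    have hBj := hab (m - (j + 1)) (by omega)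
    have h0 := (abs_nonneg _).trans hBj
    rw [abs_mul, abs_mul, abs_of_nonneg (hun _)]
    have e1 : |(V : ℝ) * (j + 2) - ((m : ℝ) - (j + 1))| ≤ V * ((j : ℝ) + 2 + m) := by
      have hjm : ((j : ℝ) + 1) ≤ m := by exact_mod_cast hj'
      have hj0 : (0 : ℝ) ≤ j := by positivity
      rw [abs_le]
      constructor <;> nlinarith
    have e2 : u (j + 2) ≤ K ^ (j + 2) / V ^ 2 := by
      refine (huK _).trans ?_
      rw [div_pow]
      gcongr
      · omega
    have e3 : ((j : ℝ) + 2 + m) * K ^ (j + 2) * B (m - (j + 1)) / V =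
      (V * ((j : ℝ) + 2 + m)) * (K ^ (j + 2) / V ^ 2) * B (m - (j + 1)) := by
      field_simp
    rw [e3]
    have := hun (j + 2)
    gcongr

open PowerSeries in
lemma zr_pLam (d : ℕ) (c : ℕ → ℝ) (α : ℝ) (Λ : Finset (Fin d → ℤ)) (n : ℕ) :
    pLam d c α Λ n =
      coeff n ((PowerSeries.mk (fun k => α ^ k / cfact c k)) ^ Λ.card) / (Zfun c α) ^ Λ.card := by
  unfold pLam
  congr 1
  classical
  rw [← Finset.prod_const, coeff_prod]
  rw [tsum_eq_sum (s := (Finset.finsuppAntidiag Λ n).image (fun l : (Fin d → ℤ) →₀ ℕ => (⇑l : (Fin d → ℤ) → ℕ)))]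
  · rw [Finset.sum_image (fun a _ b _ h => DFunLike.coe_injective h)]
    refine Finset.sum_congr rfl fun l hl => ?_
    rw [Finset.mem_finsuppAntidiag] at hl
    rw [Set.indicator_of_mem]
    · simp
    · refine ⟨fun x hx => ?_, hl.1⟩
      by_contra h
      exact hx (hl.2 (Finsupp.mem_support_iff.mpr h))
  · intro η hη
    rw [Set.indicator_of_notMem]
    rintro ⟨h1, h2⟩
    apply hη
    rw [Finset.mem_image]
    refine ⟨Finsupp.onFinset Λ η (fun x hx => by by_contra h; exact hx (h1 x h)), ?_, rfl⟩
    rw [Finset.mem_finsuppAntidiag]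
    exact ⟨h2, Finsupp.support_onFinset_subset⟩

lemma zr_cfact_pos (c : ℕ → ℝ) (hcpos : ∀ n : ℕ, 0 < n → 0 < c n) (k : ℕ) : 0 < cfact c k := by
  induction k with
  | zero => simp [cfact]
  | succ k ih => exact mul_pos ih (hcpos _ (by omega))

lemma zr_cfact_ge (c : ℕ → ℝ) (δ : ℝ) (hδ : 0 < δ) (h : ∀ n : ℕ, 0 < n → δ ≤ c n) (k : ℕ) :
    δ ^ k ≤ cfact c k := by
  induction k with
  | zero => simp [cfact]
  | succ k ih =>
    rw [pow_succ]
    have := h (k + 1) (by omega)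
    exact mul_le_mul ih this hδ.le ((pow_pos hδ k).le.trans ih)

lemma zr_delta (c : ℕ → ℝ) (a₂ : ℝ) (k₀ : ℕ)
    (hc0 : c 0 = 0) (hcpos : ∀ n : ℕ, 0 < n → 0 < c n) (ha₂ : 0 < a₂)
    (hM : ∀ j k : ℕ, j + k₀ ≤ k → a₂ ≤ c k - c j) :
    ∃ δ > 0, ∀ n : ℕ, 0 < n → δ ≤ c n := by
  have : ∀ m : ℕ, ∃ δ > 0, ∀ n : ℕ, 0 < n → n ≤ m → δ ≤ c n := by
    intro m
    induction m with
    | zero => exact ⟨1, one_pos, fun n h1 h2 => by omega⟩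
    | succ m ih =>
      obtain ⟨δ, h1, h2⟩ := ih
      refine ⟨min δ (c (m + 1)), lt_min h1 (hcpos _ (by omega)), fun n hn hn' => ?_⟩
      rcases Nat.lt_or_ge m n with h | h
      · have : n = m + 1 := by omega
        subst this; exact min_le_right _ _
      · exact (min_le_left _ _).trans (h2 n hn h)
  obtain ⟨δ, h1, h2⟩ := this k₀
  refine ⟨min δ a₂, lt_min h1 ha₂, fun n hn => ?_⟩
  rcases le_total n k₀ with h | h
  · exact (min_le_left _ _).trans (h2 n hn h)
  · have := hM 0 n (by omega)
    rw [hc0] at this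
    exact (min_le_right _ _).trans (by linarith)

/-- From a nonzero mean: summability and the bound `α ≤ a₁ · mean`. -/
lemma zr_alpha (c : ℕ → ℝ) (a₁ : ℝ) (hc0 : c 0 = 0) (hcpos : ∀ n : ℕ, 0 < n → 0 < c n)
    (hLG : ∀ k : ℕ, |c (k + 1) - c k| ≤ a₁) (α : ℝ) (hα : 0 < α) (r : ℝ) (hr : 0 < r)
    (hm : meanGC c α = r) :
    Summable (fun k : ℕ => α ^ k / cfact c k) ∧
    Summable (fun k : ℕ => (k : ℝ) * α ^ k / cfact c k) ∧
    ∑' k : ℕ, (k : ℝ) * α ^ k / cfact c k = r * Zfun c α ∧ 1 ≤ Zfun c α ∧ α ≤ a₁ * r := by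
  have hcf := zr_cfact_pos c hcpos
  unfold meanGC at hm
  have hZ : Zfun c α ≠ 0 := by
    intro h; rw [h, div_zero] at hm; linarith
  have hnum : ∑' k : ℕ, (k : ℝ) * α ^ k / cfact c k ≠ 0 := by
    intro h; rw [h, zero_div] at hm; linarith
  have s1 : Summable (fun k : ℕ => α ^ k / cfact c k) := by
    by_contra h; exact hZ (tsum_eq_zero_of_not_summable h)
  have s2 : Summable (fun k : ℕ => (k : ℝ) * α ^ k / cfact c k) := by
    by_contra h; exact hnum (tsum_eq_zero_of_not_summable h)
  have hmul : ∑' k : ℕ, (k : ℝ) * α ^ k / cfact c k = r * Zfun c α := by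
    rw [← hm]; field_simp
  have hZ1 : 1 ≤ Zfun c α := by
    have := s1.le_tsum 0 (fun k _ => (div_pos (pow_pos hα k) (hcf k)).le)
    simpa [cfact, Zfun] using this
  refine ⟨s1, s2, hmul, hZ1, ?_⟩
  have hck : ∀ k : ℕ, c k ≤ a₁ * k := by
    intro k
    induction k with
    | zero => simp [hc0]
    | succ k ih =>
      have := (abs_le.mp (hLG k)).2
      push_cast; linarith
  have hle : α * Zfun c α ≤ a₁ * ∑' k : ℕ, (k : ℝ) * α ^ k / cfact c k := by
    rw [s2.tsum_eq_zero_add, Zfun, ← tsum_mul_left]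
    simp only [Nat.cast_zero, zero_mul, zero_div, zero_add]
    rw [← tsum_mul_left]
    refine Summable.tsum_le_tsum (fun k => ?_) (s1.mul_left α)
      (((summable_nat_add_iff 1).mpr s2).mul_left a₁)
    have h1 := hck (k + 1)
    have h2 := hcpos (k + 1) (by omega)
    have h3 := hcf k
    have : α * (α ^ k / cfact c k) = c (k + 1) * (α ^ (k + 1) / cfact c (k + 1)) := by
      simp only [cfact]
      field_simp
      ring
    rw [this]
    calc _ ≤ a₁ * ((k + 1 : ℕ) : ℝ) * (α ^ (k + 1) / cfact c (k + 1)) := by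
          have := hcf (k + 1)
          gcongr
      _ = _ := by ring
  rw [hmul, ← mul_assoc] at hle
  exact le_of_mul_le_mul_right hle (by linarith)

lemma zr_tail (u : ℕ → ℝ) (hu0 : u 0 = 1) (x : ℝ) (hx0 : 0 ≤ x) (hx : x ≤ 1 / 2)
    (hun : ∀ k, 0 ≤ u k) (huK : ∀ k, u k ≤ x ^ k)
    (s1 : Summable u) (s2 : Summable (fun k : ℕ => (k : ℝ) * u k)) :
    1 + u 1 ≤ ∑' k, u k ∧ ∑' k, u k ≤ 1 + u 1 + 8 * x ^ 2 ∧
    u 1 ≤ ∑' k : ℕ, (k : ℝ) * u k ∧ ∑' k : ℕ, (k : ℝ) * u k ≤ u 1 + 8 * x ^ 2 := by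
  have e1 := s1.sum_add_tsum_nat_add 2
  have e2 := s2.sum_add_tsum_nat_add 2
  simp only [Finset.sum_range_succ, Finset.sum_range_zero, hu0] at e1 e2
  have s1' := (summable_nat_add_iff 2).mpr s1
  have s2' := (summable_nat_add_iff 2).mpr s2
  have p1 : 0 ≤ ∑' k, u (k + 2) := tsum_nonneg fun k => hun _
  have h12 : ∑' k, u (k + 2) ≤ ∑' k : ℕ, ((k + 2 : ℕ) : ℝ) * u (k + 2) := by
    refine Summable.tsum_le_tsum (fun k => ?_) s1' s2'
    refine le_mul_of_one_le_left (hun _) ?_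
    push_cast; have : (0 : ℝ) ≤ k := by positivity
    linarith
  have hg : ‖(1 / 2 : ℝ)‖ < 1 := by norm_num
  have t1 := tsum_coe_mul_geometric_of_norm_lt_one hg
  have st1 := (hasSum_coe_mul_geometric_of_norm_lt_one hg).summable
  have st2 := summable_geometric_of_norm_lt_one hg
  have t2 := tsum_geometric_of_norm_lt_one hg
  have h2 : ∑' k : ℕ, ((k + 2 : ℕ) : ℝ) * u (k + 2) ≤ 8 * x ^ 2 := by
    have sm : Summable (fun k : ℕ => x ^ 2 * ((k : ℝ) * (1 / 2) ^ k + 2 * (1 / 2) ^ k)) :=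
      (st1.add (st2.mul_left 2)).mul_left _
    calc _ ≤ ∑' k : ℕ, x ^ 2 * ((k : ℝ) * (1 / 2) ^ k + 2 * (1 / 2) ^ k) := by
          refine Summable.tsum_le_tsum (fun k => ?_) s2' sm
          have : u (k + 2) ≤ x ^ 2 * (1 / 2) ^ k := by
            refine (huK _).trans ?_
            rw [pow_add, mul_comm]
            gcongr
          calc _ ≤ ((k + 2 : ℕ) : ℝ) * (x ^ 2 * (1 / 2) ^ k) := by gcongr
            _ = _ := by push_cast; ring
      _ ≤ 8 * x ^ 2 := by
          rw [tsum_mul_left, Summable.tsum_add st1 (st2.mul_left 2), tsum_mul_left, t1, t2]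
          norm_num; nlinarith [sq_nonneg x]
  norm_num at e1 e2
  push_cast at h12 h2
  refine ⟨by linarith, by linarith, by linarith, by linarith⟩

lemma zr_exp (s t : ℝ) (hs : 0 ≤ s) (ht : 0 ≤ t) : |Real.exp (-s) - Real.exp (-t)| ≤ |s - t| := by
  wlog h : s ≤ t generalizing s t
  · rw [abs_sub_comm, abs_sub_comm s t]; exact this t s ht hs (le_of_not_ge h)
  have h1 : Real.exp (-t) ≤ Real.exp (-s) := Real.exp_le_exp.mpr (by linarith)
  rw [abs_of_nonneg (by linarith), abs_sub_comm, abs_of_nonneg (by linarith)]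
  have h2 : Real.exp (-t) = Real.exp (-s) * Real.exp (-(t - s)) := by
    rw [← Real.exp_add]; ring_nf
  have h3 := Real.add_one_le_exp (-(t - s))
  have h4 : Real.exp (-s) ≤ 1 := Real.exp_le_one_iff.mpr (by linarith)
  have h5 := Real.exp_pos (-s)
  rw [h2]
  nlinarith

set_option maxHeartbeats 1000000

/-- Lemma 6.1: Poisson approximation of `p_Λ^{N/|Λ|}(n)` for `0 < n ≤ N ≤ N₀`, with error
`A₀/|Λ|` uniform over finite `Λ ⊂ ℤ^d`.  Here `α` is the fugacity `α(N/|Λ|)`. -/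
theorem statement19 (d : ℕ) (hd : 1 ≤ d)
    (c : ℕ → ℝ) (a₁ a₂ : ℝ) (k₀ : ℕ)
    (hc0 : c 0 = 0) (hcpos : ∀ n : ℕ, 0 < n → 0 < c n)
    (hLG : ∀ k : ℕ, |c (k + 1) - c k| ≤ a₁)
    (hk₀ : 0 < k₀) (ha₂ : 0 < a₂)
    (hM : ∀ j k : ℕ, j + k₀ ≤ k → a₂ ≤ c k - c j)
    (N₀ : ℕ) (hN₀ : 1 ≤ N₀) :
    ∃ A₀ : ℝ, 0 < A₀ ∧
      ∀ (Λ : Finset (Fin d → ℤ)), Λ.Nonempty →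
        ∀ n N : ℕ, 0 < n → n ≤ N → N ≤ N₀ →
        ∀ α : ℝ, 0 < α → meanGC c α = (N : ℝ) / (Λ.card : ℝ) →
          |pLam d c α Λ n - (N : ℝ) ^ n / (Nat.factorial n : ℝ) * Real.exp (-(N : ℝ))|
            ≤ A₀ / (Λ.card : ℝ) := by
  classical
  obtain ⟨δ, hδ, hcδ⟩ := zr_delta c a₂ k₀ hc0 hcpos ha₂ hM
  have ha₁ : 0 < a₁ := by
    have h1 := hLG 0
    have h2 := hcpos 1 one_pos
    rw [hc0] at h1
    have h3 := (le_abs_self _).trans h1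
    simp only [zero_add, sub_zero] at h3
    linarith
  obtain ⟨K, hKdef⟩ : ∃ K : ℝ, K = a₁ * N₀ / δ := ⟨_, rfl⟩
  have hK : 0 ≤ K := by rw [hKdef]; positivity
  choose C hC0 hC using zr_coeff K hK
  obtain ⟨Ct, hCt⟩ : ∃ Ct : ℝ, Ct = ∑ n ∈ Finset.range (N₀ + 1), C n := ⟨_, rfl⟩
  have hCt0 : 0 ≤ Ct := by rw [hCt]; exact Finset.sum_nonneg fun n _ => hC0 n
  have hCle : ∀ n, n ≤ N₀ → C n ≤ Ct := fun n hn => by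
    rw [hCt]
    exact Finset.single_le_sum (f := C) (fun n _ => hC0 n) (Finset.mem_range.mpr (by omega))
  have hN0' : (0 : ℝ) ≤ N₀ := by positivity
  obtain ⟨R, hR⟩ : ∃ R : ℝ, R = K + N₀ + 1 := ⟨_, rfl⟩
  have hR1 : 1 ≤ R := by linarith
  obtain ⟨E, hE⟩ : ∃ E : ℝ, E = 8 * K ^ 2 + 5 * N₀ * K := ⟨_, rfl⟩
  have hE0 : 0 ≤ E := by rw [hE]; positivity
  have hB1 : 0 ≤ Ct + E * (N₀ * R ^ N₀) + R ^ N₀ * (8 * K ^ 2 + E) := by positivity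
  have hB2 : 0 ≤ (Ct + 2 * R ^ N₀) * (2 * K) := by positivity
  refine ⟨(Ct + E * (N₀ * R ^ N₀) + R ^ N₀ * (8 * K ^ 2 + E)) + (Ct + 2 * R ^ N₀) * (2 * K) + 1,
    by linarith, ?_⟩
  intro Λ hΛ n N hn hnN hN α hα hmean
  rw [zr_pLam]
  have hV : 1 ≤ Λ.card := hΛ.card_pos
  generalize Λ.card = V at *
  have hV1 : (1 : ℝ) ≤ V := by exact_mod_cast hV
  have hVp : (0 : ℝ) < V := by linarith
  have hNp : (0 : ℝ) < N := by exact_mod_cast (by omega : 0 < N)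
  have hNN : (N : ℝ) ≤ N₀ := by exact_mod_cast hN
  obtain ⟨s1, s2, hmul, hZ1, hαle⟩ := zr_alpha c a₁ hc0 hcpos hLG α hα _ (div_pos hNp hVp) hmean
  have hcf := zr_cfact_pos c hcpos
  have hZe : Zfun c α = ∑' k : ℕ, α ^ k / cfact c k := rfl
  set Z := Zfun c α with hZ
  have hnum : ∑' k : ℕ, (k : ℝ) * (α ^ k / cfact c k) = N / V * Z := by
    rw [← hmul]; exact tsum_congr fun k => by ring
  have s2' : Summable (fun k : ℕ => (k : ℝ) * (α ^ k / cfact c k)) :=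
    s2.congr fun k => by ring
  obtain ⟨u, hu⟩ : ∃ u : ℕ → ℝ, u = fun k => α ^ k / cfact c k := ⟨_, rfl⟩
  have hu0 : u 0 = 1 := by simp [hu, cfact]
  have hun : ∀ k, 0 ≤ u k := fun k => by
    have := hcf k
    rw [hu]; positivity
  have huK : ∀ k, u k ≤ (K / V) ^ k := fun k => by
    have h1 := zr_cfact_ge c δ hδ hcδ k
    have h2 : u k ≤ (α / δ) ^ k := by
      rw [hu, div_pow]
      have := pow_pos hδ k
      show α ^ k / cfact c k ≤ _
      gcongr
    refine h2.trans (pow_le_pow_left₀ (by positivity) ?_ k)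
    rw [hKdef]
    calc α / δ ≤ (a₁ * (N / V)) / δ := by gcongr
      _ ≤ (a₁ * (N₀ / V)) / δ := by gcongr
      _ = _ := by ring
  have hun' : ∀ k, α ^ k / cfact c k = u k := fun k => by rw [hu]
  simp only [hun'] at s1 s2' hZe hnum ⊢
  have hCn := hC n u V hV hu0 hun huK
  change |PowerSeries.coeff n (PowerSeries.mk u ^ V) - _| ≤ _ at hCn
  change |PowerSeries.coeff n (PowerSeries.mk u ^ V) / _ - _| ≤ _
  generalize PowerSeries.coeff n (PowerSeries.mk u ^ V) = a at *
  have hCnV : C n / V ≤ Ct / V := by have := hCle n (by omega)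
                                     gcongr
  have hu1 : u 1 ≤ K / V := by simpa using huK 1
  have hlam0 : 0 ≤ V * u 1 := mul_nonneg hVp.le (hun 1)
  have hlamK : V * u 1 ≤ K := by
    rw [le_div_iff₀ hVp] at hu1; linarith
  obtain ⟨lam, hlam⟩ : ∃ lam : ℝ, lam = V * u 1 := ⟨_, rfl⟩
  rw [← hlam] at hlam0 hlamK hCn
  have hfac : (1 : ℝ) ≤ n.factorial := by exact_mod_cast n.factorial_pos
  have hpowR : ∀ y : ℝ, 0 ≤ y → y ≤ R → y ^ n / (n.factorial : ℝ) ≤ R ^ N₀ := fun y hy0 hy => by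
    refine (div_le_self (by positivity) hfac).trans ?_
    exact (pow_le_pow_left₀ hy0 hy n).trans (pow_le_pow_right₀ hR1 (by omega))
  have hPN := hpowR N hNp.le (by linarith)
  have hPN0 : 0 ≤ (N : ℝ) ^ n / (n.factorial : ℝ) := by positivity
  have hPl := hpowR lam hlam0 (by linarith)
  have hPl0 : 0 ≤ lam ^ n / (n.factorial : ℝ) := by positivity
  have heN : Real.exp (-(N : ℝ)) ≤ 1 := Real.exp_le_one_iff.mpr (by linarith)
  have heN0 := Real.exp_pos (-(N : ℝ))
  have hZV : 1 ≤ Z ^ V := one_le_pow₀ hZ1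
  by_cases hbig : K / V ≤ 1 / 2
  · obtain ⟨z1, z2, w1, w2⟩ := zr_tail u hu0 (K / V) (by positivity) hbig hun huK s1 s2'
    rw [← hZe] at z1 z2
    rw [hnum] at w1 w2
    have hZpos : 0 < Z := by linarith
    obtain ⟨s, hs⟩ : ∃ s : ℝ, s = V * Real.log Z := ⟨_, rfl⟩
    have hexp : Z ^ V = Real.exp s := by
      rw [hs, mul_comm, Real.exp_mul, Real.exp_log hZpos, Real.rpow_natCast]
    have hs0 : 0 ≤ s := by
      rw [hs]; exact mul_nonneg hVp.le (Real.log_nonneg hZ1)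
    have hVx : V * (8 * (K / V) ^ 2) = 8 * K ^ 2 / V := by field_simp
    have hs_le : s ≤ lam + 8 * K ^ 2 / V := by
      have h1 := Real.log_le_sub_one_of_pos hZpos
      rw [hs, hlam, ← hVx, ← mul_add]
      exact mul_le_mul_of_nonneg_left (by linarith) hVp.le
    have hs_ge : lam - K ^ 2 / V ≤ s := by
      have hp : 0 < 1 + u 1 := by linarith [hun 1]
      have h1 : Real.log (1 + u 1) ≤ Real.log Z := Real.log_le_log hp z1
      have h2 := Real.one_sub_inv_le_log_of_pos hp
      have h3 : u 1 - (K / V) ^ 2 ≤ 1 - (1 + u 1)⁻¹ := by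
        have h4 : 1 - (1 + u 1)⁻¹ = u 1 - u 1 ^ 2 / (1 + u 1) := by field_simp; ring
        have h5 : u 1 ^ 2 / (1 + u 1) ≤ u 1 ^ 2 := div_le_self (sq_nonneg _) (by linarith [hun 1])
        have h6 : u 1 ^ 2 ≤ (K / V) ^ 2 := pow_le_pow_left₀ (hun 1) hu1 2
        linarith
      have h7 : lam - K ^ 2 / V = V * (u 1 - (K / V) ^ 2) := by
        rw [hlam]; field_simp
      rw [h7, hs]
      exact mul_le_mul_of_nonneg_left (by linarith) hVp.le
    have hNZ : V * (N / V * Z) = N * Z := by field_simp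
    have hN_le : (N : ℝ) ≤ lam + 8 * K ^ 2 / V := by
      have h1 := mul_le_mul_of_nonneg_left w2 hVp.le
      rw [hNZ, mul_add, hVx, ← hlam] at h1
      exact (le_mul_of_one_le_right hNp.le hZ1).trans h1
    have hN_ge : lam - 5 * N₀ * K / V ≤ N := by
      have h1 := mul_le_mul_of_nonneg_left w1 hVp.le
      rw [hNZ, ← hlam] at h1
      have h2 : Z ≤ 1 + 5 * (K / V) := by
        have h0 : 0 ≤ K / V := by positivity
        have h00 : (K / V) ^ 2 ≤ (K / V) * (1 / 2) := by
          rw [sq]; exact mul_le_mul_of_nonneg_left hbig h0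
        linarith
      have h3 : N * Z ≤ N + 5 * N₀ * K / V := by
        have h0 : 0 ≤ K / V := by positivity
        calc N * Z ≤ N * (1 + 5 * (K / V)) := by gcongr
          _ = N + 5 * N * (K / V) := by ring
          _ ≤ N + 5 * N₀ * (K / V) := by gcongr
          _ = _ := by ring
      linarith
    have hEV : E / V = 8 * K ^ 2 / V + 5 * N₀ * K / V := by rw [hE]; ring
    have q1 : 0 ≤ 8 * K ^ 2 / V := by positivity
    have q2 : 0 ≤ 5 * N₀ * K / V := by positivity
    have q3 : K ^ 2 / V ≤ 8 * K ^ 2 / V := by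
      exact div_le_div_of_nonneg_right (by linarith [sq_nonneg K]) hVp.le
    have hlN : |lam - N| ≤ E / V := by
      rw [abs_le]; constructor <;> linarith
    have hsN : |s - N| ≤ (8 * K ^ 2 + E) / V := by
      rw [add_div, abs_le]; constructor <;> linarith
    have hpow : |lam ^ n / (n.factorial : ℝ) - (N : ℝ) ^ n / (n.factorial : ℝ)| ≤ E / V * (N₀ * R ^ N₀) := by
      rw [← sub_div, abs_div, abs_of_nonneg (by positivity : (0 : ℝ) ≤ n.factorial)]
      refine (div_le_self (abs_nonneg _) hfac).trans ?_
      refine (abs_pow_sub_pow_le lam N n).trans ?_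
      have hmax : max |lam| |(N : ℝ)| ≤ R := by
        rw [abs_of_nonneg hlam0, abs_of_nonneg hNp.le]
        exact max_le (by linarith) (by linarith)
      have hmax0 : 0 ≤ max |lam| |(N : ℝ)| := le_max_of_le_left (abs_nonneg _)
      have hnN0 : (n : ℝ) ≤ N₀ := by exact_mod_cast (by omega : n ≤ N₀)
      have h5 : max |lam| |(N : ℝ)| ^ (n - 1) ≤ R ^ N₀ :=
        (pow_le_pow_left₀ hmax0 hmax _).trans (pow_le_pow_right₀ hR1 (by omega))
      rw [mul_assoc]
      gcongr
    have hes : Real.exp (-s) ≤ 1 := Real.exp_le_one_iff.mpr (by linarith)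
    have hes0 := Real.exp_pos (-s)
    have hee := (zr_exp s N hs0 hNp.le).trans hsN
    have haN : |a - (N : ℝ) ^ n / (n.factorial : ℝ)| ≤ Ct / V + E / V * (N₀ * R ^ N₀) := by
      refine (abs_sub_le _ (lam ^ n / (n.factorial : ℝ)) _).trans ?_
      linarith
    have hdec : a / Z ^ V - (N : ℝ) ^ n / (n.factorial : ℝ) * Real.exp (-(N : ℝ)) =
        (a - (N : ℝ) ^ n / (n.factorial : ℝ)) * Real.exp (-s) +
        (N : ℝ) ^ n / (n.factorial : ℝ) * (Real.exp (-s) - Real.exp (-(N : ℝ))) := by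
      rw [hexp, Real.exp_neg s]; ring
    rw [hdec]
    have f1 : |(a - (N : ℝ) ^ n / (n.factorial : ℝ)) * Real.exp (-s)| ≤ Ct / V + E / V * (N₀ * R ^ N₀) := by
      rw [abs_mul, abs_of_pos hes0]
      exact (mul_le_of_le_one_right (abs_nonneg _) hes).trans haN
    have f2 : |(N : ℝ) ^ n / (n.factorial : ℝ) * (Real.exp (-s) - Real.exp (-(N : ℝ)))| ≤
        R ^ N₀ * ((8 * K ^ 2 + E) / V) := by
      rw [abs_mul, abs_of_nonneg hPN0]
      exact mul_le_mul hPN hee (abs_nonneg _) (by positivity)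
    refine (abs_add_le _ _).trans ((add_le_add f1 f2).trans ?_)
    have : Ct / V + E / V * (N₀ * R ^ N₀) + R ^ N₀ * ((8 * K ^ 2 + E) / V) =
      (Ct + E * (N₀ * R ^ N₀) + R ^ N₀ * (8 * K ^ 2 + E)) / V := by ring
    rw [this]
    exact div_le_div_of_nonneg_right (by linarith) hVp.le
  · have hVK : (V : ℝ) ≤ 2 * K := by
      rw [not_le, lt_div_iff₀ hVp] at hbig; linarith
    have ha : |a| ≤ Ct + R ^ N₀ := by
      have h1 := abs_sub_abs_le_abs_sub a (lam ^ n / (n.factorial : ℝ))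
      rw [abs_of_nonneg hPl0] at h1
      have h2 : Ct / V ≤ Ct := div_le_self hCt0 hV1
      linarith
    have h1 : |a / Z ^ V| ≤ Ct + R ^ N₀ := by
      rw [abs_div, abs_of_pos (by linarith : 0 < Z ^ V)]
      exact (div_le_self (abs_nonneg _) hZV).trans ha
    have h2 : |(N : ℝ) ^ n / (n.factorial : ℝ) * Real.exp (-(N : ℝ))| ≤ R ^ N₀ := by
      rw [abs_mul, abs_of_nonneg hPN0, abs_of_pos heN0]
      exact (mul_le_of_le_one_right hPN0 heN).trans hPN
    refine (abs_sub _ _).trans ((add_le_add h1 h2).trans ?_)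
    rw [le_div_iff₀ hVp]
    have h3 : (Ct + R ^ N₀ + R ^ N₀) * V ≤ (Ct + 2 * R ^ N₀) * (2 * K) := by
      rw [add_assoc, ← two_mul]
      gcongr
    linarith
end
end
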